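/- arXiv:1310.2339 — 2 statements merged into one kernel-verified Lean document; each statement's English description precedes it below -/
import Mathlib

section
/- Suppose a < 0 and a + b < 0. Then for every fixed lag Δ ≥ 0, lim_{t→∞} Cov(X(t), X(t+Δ)) = (σ² / (2|a|)) · e^{aΔ}. -/
open MeasureTheory ProbabilityTheory Filter Real Set

noncomputable section

/-- `B` is a standard one-dimensional Brownian motion adapted to the filtration `F`
under the probability measure `P`: all paths are continuous and start at `0`, the
increment `B t - B s` is Gaussian with mean `0` and variance `t - s`, and increments
after time `s` are independent of `F s`. -/
def IsStdBrownian {Ω : Type*} {mΩ : MeasurableSpace Ω} (P : Measure Ω)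
    (F : MeasureTheory.Filtration ℝ mΩ) (B : ℝ → Ω → ℝ) : Prop :=
  MeasureTheory.Adapted F B ∧
  (∀ ω, B 0 ω = 0) ∧
  (∀ ω, Continuous fun t => B t ω) ∧
  (∀ s t : ℝ, 0 ≤ s → s ≤ t →
    P.map (fun ω => B t ω - B s ω) = gaussianReal 0 (Real.toNNReal (t - s))) ∧
  (∀ s t : ℝ, 0 ≤ s → s ≤ t →
    Indep (MeasurableSpace.comap (fun ω => B t ω - B s ω) Real.measurableSpace) (F s) P)

/-- `X` is the (continuous, adapted) solution of the affine stochastic functional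
differential equation `dX(t) = (a X(t) + b/(1+t) ∫_{-1}^t X(s) ds) dt + σ dB(t)` for
`t ≥ 0`, with initial history `ψ` on `[-1, 0]`; i.e. almost surely, for all `t ≥ 0`,
`X t = ψ 0 + ∫_0^t (a X(s) + b/(1+s) (∫_{-1}^0 ψ(u) du + ∫_0^s X(u) du)) ds + σ B t`. -/
def IsSolutionSFDE {Ω : Type*} {mΩ : MeasurableSpace Ω} (P : Measure Ω)
    (F : MeasureTheory.Filtration ℝ mΩ) (a b σ : ℝ) (ψ : ℝ → ℝ)
    (B X : ℝ → Ω → ℝ) : Prop :=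
  (∀ t : ℝ, 0 ≤ t → StronglyMeasurable[F t] (X t)) ∧
  (∀ ω, ContinuousOn (fun t => X t ω) (Set.Ici (0 : ℝ))) ∧
  (∀ᵐ ω ∂P, ∀ t : ℝ, 0 ≤ t →
    X t ω = ψ 0
      + (∫ s in (0:ℝ)..t,
          (a * X s ω + b / (1 + s) * ((∫ u in (-1:ℝ)..(0:ℝ), ψ u) + ∫ u in (0:ℝ)..s, X u ω)))
      + σ * B t ω)

/-- The covariance `Cov(Y, Z) = E[Y Z] - E[Y] E[Z]` of two real random variables. -/
def rcov {Ω : Type*} {mΩ : MeasurableSpace Ω} (P : Measure Ω) (Y Z : Ω → ℝ) : ℝ :=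
  (∫ ω, Y ω * Z ω ∂P) - (∫ ω, Y ω ∂P) * (∫ ω, Z ω ∂P)

/-- Integrated form of the linear differential inequality with right-hand side `k (C - κ f)`,
where `k` is the derivative of `K`. -/
lemma le_of_hasDerivAt_le_mul_sub {f f' K k : ℝ → ℝ} {κ C T : ℝ} (hκ : 0 < κ)
    (hf : ∀ t, T ≤ t → HasDerivAt f (f' t) t) (hK : ∀ t, T ≤ t → HasDerivAt K (k t) t)
    (hle : ∀ t, T ≤ t → f' t ≤ k t * (C - κ * f t)) {t : ℝ} (ht : T ≤ t) :
    f t ≤ C / κ + (f T - C / κ) * exp (κ * (K T - K t)) := by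
  have hder : ∀ s, T ≤ s → HasDerivAt (fun s => (f s - C / κ) * exp (κ * K s))
      (f' s * exp (κ * K s) + (f s - C / κ) * (exp (κ * K s) * (κ * k s))) s := fun s hs =>
    ((hf s hs).sub_const _).mul ((hK s hs).const_mul κ).exp
  have hanti : AntitoneOn (fun s => (f s - C / κ) * exp (κ * K s)) (Ici T) := by
    refine antitoneOn_of_deriv_nonpos (convex_Ici T)
      (fun s hs => (hder s hs).continuousAt.continuousWithinAt)
      (fun s hs => (hder s (interior_subset hs)).differentiableAt.differentiableWithinAt) ?_
    intro s hs
    have hs' : T ≤ s := interior_subset hs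
    rw [(hder s hs').deriv]
    have h1 := hle s hs'
    have h2 : f' s * exp (κ * K s) + (f s - C / κ) * (exp (κ * K s) * (κ * k s))
        = exp (κ * K s) * (f' s - k s * (C - κ * f s)) := by
      field_simp
      ring
    rw [h2]
    exact mul_nonpos_of_nonneg_of_nonpos (exp_pos _).le (by linarith)
  have h := hanti (mem_Ici.2 le_rfl) (mem_Ici.2 ht) ht
  have hsplit : exp (κ * (K T - K t)) * exp (κ * K t) = exp (κ * K T) := by
    rw [← exp_add]
    ring_nf
  have hpos := exp_pos (κ * K t)
  have : (f t - C / κ) * exp (κ * K t)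
      ≤ ((f T - C / κ) * exp (κ * (K T - K t))) * exp (κ * K t) := by
    rw [mul_assoc, hsplit]
    exact h
  linarith [le_of_mul_le_mul_right this hpos]

lemma bounded_of_hasDerivAt_le {f f' K k : ℝ → ℝ} {κ C T : ℝ} (hκ : 0 < κ)
    (hf : ∀ t, T ≤ t → HasDerivAt f (f' t) t) (hK : ∀ t, T ≤ t → HasDerivAt K (k t) t)
    (hKT : ∀ t, T ≤ t → K T ≤ K t)
    (hle : ∀ t, T ≤ t → f' t ≤ k t * (C - κ * f t)) {t : ℝ} (ht : T ≤ t) :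
    f t ≤ C / κ + |f T - C / κ| := by
  refine (le_of_hasDerivAt_le_mul_sub hκ hf hK hle ht).trans ?_
  have h1 : exp (κ * (K T - K t)) ≤ 1 := by
    rw [exp_le_one_iff]
    exact mul_nonpos_of_nonneg_of_nonpos hκ.le (by linarith [hKT t ht])
  have h2 := (exp_pos (κ * (K T - K t))).le
  have h3 : (f T - C / κ) * exp (κ * (K T - K t)) ≤ |f T - C / κ| * 1 :=
    (mul_le_mul_of_nonneg_right (le_abs_self _) h2).trans
      (mul_le_mul_of_nonneg_left h1 (abs_nonneg _))
  linarith

lemma tendsto_zero_of_hasDerivAt_le {f f' K k e : ℝ → ℝ} {κ : ℝ} (hκ : 0 < κ)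
    (hf0 : ∀ t, 0 ≤ f t)
    (hf : ∀ᶠ t in atTop, HasDerivAt f (f' t) t) (hK : ∀ᶠ t in atTop, HasDerivAt K (k t) t)
    (hk : ∀ᶠ t in atTop, 0 ≤ k t) (hKtop : Tendsto K atTop atTop)
    (he : Tendsto e atTop (nhds 0))
    (hle : ∀ᶠ t in atTop, f' t ≤ k t * (e t - κ * f t)) :
    Tendsto f atTop (nhds 0) := by
  rw [Metric.tendsto_atTop']
  intro ε hε
  have hee : ∀ᶠ t in atTop, e t ≤ κ * ε / 2 :=
    (he.eventually (gt_mem_nhds (by positivity : (0:ℝ) < κ * ε / 2))).mono fun _ h => le_of_lt h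
  obtain ⟨T, hT⟩ := eventually_atTop.1 (hf.and (hK.and (hk.and (hee.and hle))))
  have hmain : ∀ t, T ≤ t →
      f t ≤ κ * ε / 2 / κ + (f T - κ * ε / 2 / κ) * exp (κ * (K T - K t)) := fun t ht =>
    le_of_hasDerivAt_le_mul_sub hκ (fun t ht => (hT t ht).1) (fun t ht => (hT t ht).2.1)
      (fun t ht => by
        obtain ⟨-, -, h3, h4, h5⟩ := hT t ht
        exact h5.trans (mul_le_mul_of_nonneg_left (by linarith) h3)) ht
  have hlim : Tendsto (fun t => (f T - κ * ε / 2 / κ) * exp (κ * (K T - K t))) atTop (nhds 0) := by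
    have h1 : Tendsto (fun t => κ * (K T - K t)) atTop atBot := by
      refine Tendsto.const_mul_atBot hκ ?_
      simpa [sub_eq_add_neg] using
        tendsto_atBot_add_const_left atTop (K T) (tendsto_neg_atTop_atBot.comp hKtop)
    simpa using (tendsto_exp_atBot.comp h1).const_mul (f T - κ * ε / 2 / κ)
  obtain ⟨T', hT'⟩ := eventually_atTop.1
    ((hlim.eventually (gt_mem_nhds (half_pos hε))).and (eventually_ge_atTop T))
  refine ⟨T', fun t ht => ?_⟩
  obtain ⟨h1, h2⟩ := hT' t ht.le
  have h3 := hmain t h2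
  have h4 : κ * ε / 2 / κ = ε / 2 := by field_simp
  rw [h4] at h3 h1
  rw [Real.dist_eq, sub_zero, abs_of_nonneg (hf0 t)]
  linarith

lemma hasDerivAt_log_one_add {t : ℝ} (ht : 0 ≤ t) :
    HasDerivAt (fun t : ℝ => log (1 + t)) (1 / (1 + t)) t :=
  ((hasDerivAt_id t).const_add 1).log (by simp only [id]; positivity)

lemma tendsto_log_one_add_atTop : Tendsto (fun t : ℝ => log (1 + t)) atTop atTop :=
  tendsto_log_atTop.comp (tendsto_atTop_add_const_left _ _ tendsto_id)

/-- Decay of the moments `p = E[y²]`, `q = E[Q²]` of the singularly perturbed system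
`y' = a y + b n + β (y - (1 + β) Q) / (1 + t)`, `Q' = (y - (1 + β) Q) / (1 + t)`,
with `r = E[y Q]`, `s = E[n y]` and `e = E[n²]`. -/
lemma moment_system_tendsto_zero {a b β C : ℝ} {p q r s e : ℝ → ℝ} (ha : a < 0) (hβ : 0 < 1 + β)
    (hp0 : ∀ t, 0 ≤ p t) (hq0 : ∀ t, 0 ≤ q t)
    (hr : ∀ t, 0 < t → ∀ l : ℝ, 0 < l → 2 * |r t| ≤ l * q t + l⁻¹ * p t)
    (hs : ∀ t, 0 < t → ∀ l : ℝ, 0 < l → 2 * |s t| ≤ l * p t + l⁻¹ * e t)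
    (he : ∀ t, 0 < t → e t ≤ C / (1 + t))
    (hp : ∀ t, 0 < t → HasDerivAt p
      (2 * (a * p t + b * s t + β * (1 / (1 + t)) * (p t - (1 + β) * r t))) t)
    (hq : ∀ t, 0 < t → HasDerivAt q (2 * ((1 / (1 + t)) * (r t - (1 + β) * q t))) t) :
    Tendsto p atTop (nhds 0) ∧ Tendsto q atTop (nhds 0) := by
  set γ := 1 + β with hγ
  have hforce : ∀ t, 0 < t →
      2 * (b * s t) ≤ -a * p t + (b ^ 2 / -a * |C| + 1) * (1 / (1 + t)) := by
    intro t ht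
    have ht1 : 0 < 1 + t := by linarith
    have hk : 0 < 1 / (1 + t) := by positivity
    have hna : 0 < -a := by linarith
    have he' : e t ≤ |C| * (1 / (1 + t)) := by
      refine (he t ht).trans ?_
      rw [mul_one_div]
      gcongr
      exact le_abs_self C
    rcases eq_or_ne b 0 with rfl | hb
    · have := hp0 t
      simp only [zero_mul, mul_zero]
      have : 0 ≤ -a * p t := by positivity
      have h0 : (0:ℝ) ≤ (0 ^ 2 / -a * |C| + 1) * (1 / (1 + t)) := by positivity
      linarith
    · have hb' : 0 < |b| := abs_pos.2 hb
      have h := hs t ht (-a / |b|) (by positivity)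
      have h2 : 2 * (b * s t) ≤ |b| * (2 * |s t|) := by
        have : b * s t ≤ |b| * |s t| := by rw [← abs_mul]; exact le_abs_self _
        linarith
      have h3 : |b| * (2 * |s t|) ≤ |b| * (-a / |b| * p t + (-a / |b|)⁻¹ * e t) :=
        mul_le_mul_of_nonneg_left h hb'.le
      have h4 : |b| * (-a / |b| * p t + (-a / |b|)⁻¹ * e t) = -a * p t + b ^ 2 / -a * e t := by
        rw [← sq_abs b]
        field_simp
      have h5 : b ^ 2 / -a * e t ≤ b ^ 2 / -a * (|C| * (1 / (1 + t))) :=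
        mul_le_mul_of_nonneg_left he' (by positivity)
      nlinarith
  set C₂ := b ^ 2 / -a * |C| + 1
  have hC₂ : 0 < C₂ := by
    have : 0 ≤ b ^ 2 / -a * |C| := mul_nonneg (div_nonneg (sq_nonneg _) (by linarith)) (abs_nonneg _)
    simp only [C₂]; linarith
  set D := |1 - β * γ| with hD
  have hcross : ∀ t, 0 < t → 2 * ((1 - β * γ) * r t) ≤ γ * q t + (D ^ 2 / γ) * p t := by
    intro t ht
    have hD0 : 0 ≤ D := abs_nonneg _
    have h2 : (1 - β * γ) * r t ≤ D * |r t| := by rw [hD, ← abs_mul]; exact le_abs_self _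
    rcases hD0.eq_or_lt with h | h
    · have h1 := hq0 t
      have h3 := hp0 t
      rw [← h] at h2 ⊢
      have : 0 ≤ γ * q t := by positivity
      simp only [ne_eq, OfNat.ofNat_ne_zero, not_false_eq_true, zero_pow, zero_div, zero_mul] at *
      linarith
    · have h3 := mul_le_mul_of_nonneg_left (hr t ht (γ / D) (by positivity)) hD0
      have h4 : D * (γ / D * q t + (γ / D)⁻¹ * p t) = γ * q t + (D ^ 2 / γ) * p t := by
        field_simp
      nlinarith
  set C₁ := D ^ 2 / γ + 2 * |β| with hC₁
  have hC₁0 : 0 ≤ C₁ := by positivity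
  obtain ⟨T, hT0, hT⟩ : ∃ T : ℝ, 0 < T ∧ ∀ t, T ≤ t → (C₁ + γ) * (1 / (1 + t)) ≤ -a := by
    refine ⟨(C₁ + γ) / -a + 1, ?_, fun t ht => ?_⟩
    · have : 0 ≤ (C₁ + γ) / -a := div_nonneg (by linarith) (by linarith)
      linarith
    · have h0 : 0 ≤ (C₁ + γ) / -a := div_nonneg (by linarith) (by linarith)
      have hna : 0 < -a := by linarith
      rw [mul_one_div, div_le_iff₀ (by linarith)]
      have : C₁ + γ = -a * ((C₁ + γ) / -a) := by rw [mul_div_cancel₀ _ hna.ne']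
      nlinarith
  have hbdd : ∀ t, T ≤ t → p t + q t ≤ C₂ / γ + |p T + q T - C₂ / γ| := by
    intro t ht
    refine bounded_of_hasDerivAt_le (f := fun t => p t + q t) (K := fun t => log (1 + t))
      (k := fun t => 1 / (1 + t)) hβ
      (fun t ht => (hp t (by linarith)).add (hq t (by linarith)))
      (fun t ht => hasDerivAt_log_one_add (by linarith))
      (fun t ht => log_le_log (by linarith) (by linarith)) (fun t ht => ?_) ht
    have ht0 : 0 < t := by linarith
    have hk : 0 < 1 / (1 + t) := by positivity
    have h1 := hforce t ht0
    have h2 := mul_le_mul_of_nonneg_left (hcross t ht0) hk.le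
    have h3 := mul_le_mul_of_nonneg_right (hT t ht) (hp0 t)
    have h4 : β * (1 / (1 + t)) * p t ≤ |β| * (1 / (1 + t)) * p t := by
      have := hp0 t
      gcongr
      exact le_abs_self β
    simp only [hC₁] at h3
    linarith
  set M := C₂ / γ + |p T + q T - C₂ / γ|
  have hk0 : Tendsto (fun t : ℝ => 1 / (1 + t)) atTop (nhds 0) := by
    simp only [one_div]
    exact tendsto_inv_atTop_zero.comp (tendsto_atTop_add_const_left _ _ tendsto_id)
  have hptend : Tendsto p atTop (nhds 0) := by
    refine tendsto_zero_of_hasDerivAt_le (κ := -a) (K := id) (k := fun _ => 1)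
      (e := fun t => (C₂ + |β| * (2 + γ) * M) * (1 / (1 + t)))
      (by linarith) hp0 ((eventually_gt_atTop 0).mono hp)
      (Eventually.of_forall hasDerivAt_id) (Eventually.of_forall fun _ => zero_le_one) tendsto_id
      (by simpa using hk0.const_mul (C₂ + |β| * (2 + γ) * M)) ?_
    filter_upwards [eventually_ge_atTop T] with t ht
    have ht0 : 0 < t := by linarith
    have hk : 0 < 1 / (1 + t) := by positivity
    have h1 := hforce t ht0
    have h2 := hr t ht0 1 one_pos
    have h3 := hbdd t ht
    have hp1 := hp0 t
    have hq1 := hq0 t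
    have h4 : 2 * (β * (p t - γ * r t)) ≤ |β| * (2 + γ) * M := by
      have h5 : β * (p t - γ * r t) ≤ |β| * |p t - γ * r t| := by
        rw [← abs_mul]; exact le_abs_self _
      have h6 : |p t - γ * r t| ≤ p t + γ * |r t| := by
        refine (abs_sub _ _).trans ?_
        rw [abs_mul, abs_of_nonneg hp1, abs_of_pos hβ]
      have h7 : 2 * (p t + γ * |r t|) ≤ (2 + γ) * M := by
        nlinarith
      have h8 := mul_le_mul_of_nonneg_left (h6) (abs_nonneg β)
      have h9 := mul_le_mul_of_nonneg_left (h7) (abs_nonneg β)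
      nlinarith
    have h5 := mul_le_mul_of_nonneg_left h4 hk.le
    linarith
  refine ⟨hptend, ?_⟩
  refine tendsto_zero_of_hasDerivAt_le (κ := γ) (K := fun t => log (1 + t))
      (k := fun t => 1 / (1 + t)) (e := fun t => γ⁻¹ * p t)
      hβ hq0 ((eventually_gt_atTop 0).mono hq)
      ((eventually_ge_atTop 0).mono fun _ => hasDerivAt_log_one_add)
      ((eventually_ge_atTop 0).mono fun t ht => by positivity) tendsto_log_one_add_atTop
      (by simpa using hptend.const_mul γ⁻¹) ?_
  filter_upwards [eventually_gt_atTop 0] with t ht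
  have hk : 0 < 1 / (1 + t) := by positivity
  have h1 := hr t ht γ hβ
  have h2 := le_abs_self (r t)
  have := mul_le_mul_of_nonneg_left (show 2 * (r t - γ * q t) ≤ γ⁻¹ * p t - γ * q t by linarith) hk.le
  linarith

/-- The primitive `N` of the Ornstein-Uhlenbeck path driven by `w`: it solves
`N' = a N + σ w`, `N 0 = 0`, and `a N + σ w` is the Ornstein-Uhlenbeck path itself. -/
def ouPrimitive (a σ : ℝ) (w : ℝ → ℝ) (t : ℝ) : ℝ :=
  σ * exp (a * t) * ∫ s in (0:ℝ)..t, exp (-(a * s)) * w s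

lemma hasDerivAt_ouPrimitive {a σ : ℝ} {w : ℝ → ℝ} (hw : Continuous w) (t : ℝ) :
    HasDerivAt (ouPrimitive a σ w) (a * ouPrimitive a σ w t + σ * w t) t := by
  have h1 : HasDerivAt (fun t => ∫ s in (0:ℝ)..t, exp (-(a * s)) * w s) (exp (-(a * t)) * w t) t :=
    ((by fun_prop : Continuous fun s => exp (-(a * s)) * w s)).integral_hasStrictDerivAt 0 t
      |>.hasDerivAt
  have h2 : HasDerivAt (fun t => σ * exp (a * t)) (σ * (exp (a * t) * (a * 1))) t :=
    ((hasDerivAt_id t).const_mul a).exp.const_mul σ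
  refine (h2.mul h1).congr_deriv ?_
  have h3 : exp (a * t) * exp (-(a * t)) = 1 := by rw [← exp_add]; simp
  simp only [ouPrimitive]
  linear_combination σ * w t * h3

lemma ouPrimitive_zero {a σ : ℝ} {w : ℝ → ℝ} : ouPrimitive a σ w 0 = 0 := by
  simp [ouPrimitive]

lemma ouPrimitive_eq_add {a σ : ℝ} {w : ℝ → ℝ} (hw : Continuous w) (t u : ℝ) :
    ouPrimitive a σ w u = exp (a * (u - t)) * ouPrimitive a σ w t
      + σ * exp (a * u) * ∫ s in t..u, exp (-(a * s)) * w s := by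
  have hc : Continuous fun s => exp (-(a * s)) * w s := by fun_prop
  have h := intervalIntegral.integral_add_adjacent_intervals
    (hc.intervalIntegrable (μ := volume) 0 t) (hc.intervalIntegrable t u)
  have h2 : exp (a * (u - t)) * exp (a * t) = exp (a * u) := by rw [← exp_add]; ring_nf
  simp only [ouPrimitive]
  rw [← h, ← h2]
  ring

lemma continuous_ouPrimitive {a σ : ℝ} {w : ℝ → ℝ} (hw : Continuous w) :
    Continuous (ouPrimitive a σ w) :=
  continuous_iff_continuousAt.2 fun t => (hasDerivAt_ouPrimitive hw t).continuousAt

lemma abs_ouPrimitive_le {a σ : ℝ} {w : ℝ → ℝ} (ha : a < 0) (hw : Continuous w) {t T : ℝ}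
    (ht : 0 ≤ t) (htT : t ≤ T) :
    |ouPrimitive a σ w t| ≤ |σ| * ∫ s in (0:ℝ)..T, |w s| := by
  have h1 : |∫ s in (0:ℝ)..t, exp (-(a * s)) * w s|
      ≤ exp (-(a * t)) * ∫ s in (0:ℝ)..t, |w s| := by
    refine (intervalIntegral.abs_integral_le_integral_abs ht).trans ?_
    rw [← intervalIntegral.integral_const_mul]
    refine intervalIntegral.integral_mono_on ht
      (by apply Continuous.intervalIntegrable; fun_prop)
      (by apply Continuous.intervalIntegrable; fun_prop) fun s hs => ?_
    rw [abs_mul, abs_of_pos (exp_pos _)]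
    gcongr ?_ * _
    exact exp_le_exp.2 (by nlinarith [hs.2])
  have h2 : ∫ s in (0:ℝ)..t, |w s| ≤ ∫ s in (0:ℝ)..T, |w s| :=
    intervalIntegral.integral_mono_interval le_rfl ht htT
      (Eventually.of_forall fun s => abs_nonneg _) (hw.abs.intervalIntegrable 0 T)
  have h3 : exp (a * t) * exp (-(a * t)) = 1 := by rw [← exp_add]; simp
  rw [ouPrimitive, abs_mul, abs_mul, abs_of_pos (exp_pos _)]
  calc |σ| * exp (a * t) * |∫ s in (0:ℝ)..t, exp (-(a * s)) * w s|
      ≤ |σ| * exp (a * t) * (exp (-(a * t)) * ∫ s in (0:ℝ)..t, |w s|) := by gcongr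
    _ = |σ| * ∫ s in (0:ℝ)..t, |w s| := by linear_combination (|σ| * ∫ s in (0:ℝ)..t, |w s|) * h3
    _ ≤ _ := by gcongr

/-- The integral of the solution `x` with history mass `c`, minus the Ornstein-Uhlenbeck
primitive. -/
def residualIntegral (a σ c : ℝ) (w x : ℝ → ℝ) (t : ℝ) : ℝ :=
  c + (∫ s in (0:ℝ)..t, x s) - ouPrimitive a σ w t

/-- The difference between the solution and the Ornstein-Uhlenbeck path. -/
def sfdeResidual (a b σ c x₀ : ℝ) (w x : ℝ → ℝ) (t : ℝ) : ℝ :=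
  x₀ - a * c + a * residualIntegral a σ c w x t
    + b * ∫ s in (0:ℝ)..t, (c + ∫ u in (0:ℝ)..s, x u) / (1 + |s|)

section Residual

variable {a b σ c x₀ : ℝ} {w x : ℝ → ℝ}

lemma continuous_integral_div (hx : Continuous x) :
    Continuous fun s : ℝ => (c + ∫ u in (0:ℝ)..s, x u) / (1 + |s|) := by
  have h : Continuous fun s : ℝ => ∫ u in (0:ℝ)..s, x u :=
    intervalIntegral.continuous_primitive (fun _ _ => hx.intervalIntegrable _ _) 0
  refine (continuous_const.add h).div (by fun_prop) fun s => ?_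
  positivity

lemma eq_residual_add (hx : Continuous x)
    (heq : ∀ t : ℝ, 0 ≤ t → x t = x₀ + (∫ s in (0:ℝ)..t,
      (a * x s + b / (1 + s) * (c + ∫ u in (0:ℝ)..s, x u))) + σ * w t) {t : ℝ} (ht : 0 ≤ t) :
    x t = sfdeResidual a b σ c x₀ w x t + (a * ouPrimitive a σ w t + σ * w t) := by
  have h1 : ∫ s in (0:ℝ)..t, (a * x s + b / (1 + s) * (c + ∫ u in (0:ℝ)..s, x u))
      = ∫ s in (0:ℝ)..t, (a * x s + b * ((c + ∫ u in (0:ℝ)..s, x u) / (1 + |s|))) := by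
    refine intervalIntegral.integral_congr fun s hs => ?_
    rw [uIcc_of_le ht] at hs
    simp only [abs_of_nonneg hs.1]
    ring
  rw [heq t ht, h1, intervalIntegral.integral_add ((hx.intervalIntegrable _ _).const_mul a)
    (((continuous_integral_div hx).intervalIntegrable _ _).const_mul b),
    intervalIntegral.integral_const_mul, intervalIntegral.integral_const_mul]
  simp only [sfdeResidual, residualIntegral]
  ring

lemma hasDerivAt_residualIntegral (hw : Continuous w) (hx : Continuous x)
    (heq : ∀ t : ℝ, 0 ≤ t → x t = x₀ + (∫ s in (0:ℝ)..t,
      (a * x s + b / (1 + s) * (c + ∫ u in (0:ℝ)..s, x u))) + σ * w t) {t : ℝ} (ht : 0 ≤ t) :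
    HasDerivAt (residualIntegral a σ c w x) (sfdeResidual a b σ c x₀ w x t) t := by
  have h1 : HasDerivAt (fun t => ∫ s in (0:ℝ)..t, x s) (x t) t :=
    (hx.integral_hasStrictDerivAt 0 t).hasDerivAt
  refine ((h1.const_add c).sub (hasDerivAt_ouPrimitive hw t)).congr_deriv ?_
  rw [eq_residual_add hx heq ht]
  ring

lemma hasDerivAt_residual (hw : Continuous w) (hx : Continuous x)
    (heq : ∀ t : ℝ, 0 ≤ t → x t = x₀ + (∫ s in (0:ℝ)..t,
      (a * x s + b / (1 + s) * (c + ∫ u in (0:ℝ)..s, x u))) + σ * w t) {t : ℝ} (ht : 0 ≤ t) :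
    HasDerivAt (sfdeResidual a b σ c x₀ w x) (a * sfdeResidual a b σ c x₀ w x t
      + b * ((residualIntegral a σ c w x t + ouPrimitive a σ w t) / (1 + t))) t := by
  have h1 : HasDerivAt (fun t => ∫ s in (0:ℝ)..t, (c + ∫ u in (0:ℝ)..s, x u) / (1 + |s|))
      ((c + ∫ u in (0:ℝ)..t, x u) / (1 + |t|)) t :=
    ((continuous_integral_div hx).integral_hasStrictDerivAt 0 t).hasDerivAt
  refine ((((hasDerivAt_residualIntegral hw hx heq ht).const_mul a).const_add (x₀ - a * c)).add
    (h1.const_mul b)).congr_deriv ?_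
  rw [abs_of_nonneg ht]
  simp only [residualIntegral]
  ring

lemma residual_bound (ha : a < 0) (hw : Continuous w) (hx : Continuous x)
    (heq : ∀ t : ℝ, 0 ≤ t → x t = x₀ + (∫ s in (0:ℝ)..t,
      (a * x s + b / (1 + s) * (c + ∫ u in (0:ℝ)..s, x u))) + σ * w t)
    {t T : ℝ} (ht : 0 ≤ t) (htT : t ≤ T) :
    |residualIntegral a σ c w x t| ≤ exp ((1 + |a| + |b|) * T) *
        (|c| + |x₀| + |b| * (|σ| * ∫ s in (0:ℝ)..T, |w s|)) ∧
      |sfdeResidual a b σ c x₀ w x t| ≤ exp ((1 + |a| + |b|) * T) *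
        (|c| + |x₀| + |b| * (|σ| * ∫ s in (0:ℝ)..T, |w s|)) := by
  set K := 1 + |a| + |b| with hK
  set J := residualIntegral a σ c w x
  set R := sfdeResidual a b σ c x₀ w x with hR
  set ε := |b| * (|σ| * ∫ s in (0:ℝ)..T, |w s|) with hε
  have hK1 : 1 ≤ K := by
    have := abs_nonneg a
    have := abs_nonneg b
    linarith
  have hT : 0 ≤ T := ht.trans htT
  have hε0 : 0 ≤ ε := by
    have : 0 ≤ ∫ s in (0:ℝ)..T, |w s| :=
      intervalIntegral.integral_nonneg hT fun _ _ => abs_nonneg _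
    positivity
  have hder : ∀ s, 0 ≤ s → HasDerivAt (fun s => (J s, R s))
      (R s, a * R s + b * ((J s + ouPrimitive a σ w s) / (1 + s))) s := fun s hs =>
    (hasDerivAt_residualIntegral hw hx heq hs).prodMk (hasDerivAt_residual hw hx heq hs)
  have hJ0 : J 0 = c := by simp [J, residualIntegral, ouPrimitive_zero]
  have hR0 : R 0 = x₀ := by
    simp [R, sfdeResidual, residualIntegral, ouPrimitive_zero]
  have hG := norm_le_gronwallBound_of_norm_deriv_right_le (a := 0) (b := T)
    (δ := |c| + |x₀|) (K := K) (ε := ε)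
    (fun s hs => (hder s hs.1).continuousAt.continuousWithinAt)
    (fun s hs => (hder s hs.1).hasDerivWithinAt) ?_ ?_ t ⟨ht, htT⟩
  · have hle : gronwallBound (|c| + |x₀|) K ε (t - 0) ≤ exp (K * T) * (|c| + |x₀| + ε) := by
      rw [gronwallBound_of_K_ne_0 (by positivity)]
      have h1 : ε / K ≤ ε := div_le_self hε0 hK1
      have h2 : exp (K * (t - 0)) ≤ exp (K * T) := by
        apply exp_le_exp.2
        gcongr
        linarith
      have h3 : 0 ≤ |c| + |x₀| := by positivity
      have h4 : 1 ≤ exp (K * (t - 0)) := one_le_exp (by rw [sub_zero]; positivity)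
      have h5 : ε / K * (exp (K * (t - 0)) - 1) ≤ ε * exp (K * T) :=
        mul_le_mul h1 (by linarith) (by linarith) hε0
      have h6 := mul_le_mul_of_nonneg_left h2 h3
      simp only
      linarith
    exact ⟨(norm_fst_le (J t, R t)).trans (hG.trans hle),
      (norm_snd_le (J t, R t)).trans (hG.trans hle)⟩
  · rw [hJ0, hR0, Prod.norm_def]
    simp only [Real.norm_eq_abs]
    exact max_le (by linarith [abs_nonneg x₀]) (by linarith [abs_nonneg c])
  · intro s hs
    have hJs : |J s| ≤ ‖(J s, R s)‖ := norm_fst_le (J s, R s)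
    have hRs : |R s| ≤ ‖(J s, R s)‖ := norm_snd_le (J s, R s)
    set m := ‖(J s, R s)‖
    have hm : 0 ≤ m := norm_nonneg _
    have hN := abs_ouPrimitive_le (σ := σ) ha hw hs.1 hs.2.le
    have hs1 : 1 ≤ 1 + s := by linarith [hs.1]
    have h1 : |(J s + ouPrimitive a σ w s) / (1 + s)| ≤ m + |σ| * ∫ s in (0:ℝ)..T, |w s| := by
      rw [abs_div, abs_of_pos (by linarith : 0 < 1 + s)]
      refine (div_le_self (abs_nonneg _) hs1).trans ((abs_add_le _ _).trans (by linarith))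
    rw [Prod.norm_def]
    simp only [Real.norm_eq_abs]
    refine max_le ?_ ?_
    · nlinarith [abs_nonneg a, abs_nonneg b]
    · refine (abs_add_le _ _).trans ?_
      rw [abs_mul, abs_mul]
      have h2 := mul_le_mul_of_nonneg_left h1 (abs_nonneg b)
      have h3 := mul_le_mul_of_nonneg_left hRs (abs_nonneg a)
      simp only [hK, hε]
      linarith

end Residual

section Moments

variable {Ω : Type*} {mΩ : MeasurableSpace Ω} {P : Measure Ω}

lemma integrable_fun_mul_of_memLp_two {f g : Ω → ℝ} (hf : MemLp f 2 P) (hg : MemLp g 2 P) :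
    Integrable (fun ω => f ω * g ω) P :=
  hf.integrable_mul hg

lemma two_mul_abs_integral_mul_le {f g : Ω → ℝ} (hf : MemLp f 2 P) (hg : MemLp g 2 P)
    {l : ℝ} (hl : 0 < l) :
    2 * |∫ ω, f ω * g ω ∂P| ≤ l * (∫ ω, g ω ^ 2 ∂P) + l⁻¹ * ∫ ω, f ω ^ 2 ∂P := by
  have hint : Integrable (fun ω => l * g ω ^ 2 + l⁻¹ * f ω ^ 2) P :=
    (hg.integrable_sq.const_mul l).add (hf.integrable_sq.const_mul l⁻¹)
  rw [← integral_const_mul, ← integral_const_mul,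
    ← integral_add (hg.integrable_sq.const_mul l) (hf.integrable_sq.const_mul l⁻¹)]
  have h1 : |∫ ω, f ω * g ω ∂P| ≤ ∫ ω, |f ω * g ω| ∂P := abs_integral_le_integral_abs
  have h2 : 2 * ∫ ω, |f ω * g ω| ∂P ≤ ∫ ω, (l * g ω ^ 2 + l⁻¹ * f ω ^ 2) ∂P := by
    rw [← integral_const_mul]
    refine integral_mono ((hf.integrable_mul hg).abs.const_mul 2) hint fun ω => ?_
    have h3 : 0 ≤ l⁻¹ * (l * |g ω| - |f ω|) ^ 2 := by positivity
    have h4 : l⁻¹ * (l * |g ω| - |f ω|) ^ 2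
        = l * |g ω| ^ 2 + l⁻¹ * |f ω| ^ 2 - 2 * (|f ω| * |g ω|) := by
      field_simp
      ring
    rw [h4, sq_abs, sq_abs] at h3
    simp only [abs_mul]
    linarith
  linarith

/-- The second-order data of a continuous process with the moments of Brownian motion. -/
structure HasBrownianMoments (P : Measure Ω) (B : ℝ → Ω → ℝ) : Prop where
  measurable : ∀ t, Measurable (B t)
  continuous : ∀ ω, Continuous fun t => B t ω
  memLp : ∀ t, 0 ≤ t → MemLp (B t) 2 P
  integral_eq_zero : ∀ t, 0 ≤ t → ∫ ω, B t ω ∂P = 0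
  integral_mul : ∀ s t, 0 ≤ s → s ≤ t → ∫ ω, B s ω * B t ω ∂P = s

lemma IsStdBrownian.hasBrownianMoments [IsProbabilityMeasure P]
    {F : MeasureTheory.Filtration ℝ mΩ} {B : ℝ → Ω → ℝ} (hB : IsStdBrownian P F B) :
    HasBrownianMoments P B := by
  obtain ⟨hadapt, hzero, hcont, hlaw, hindep⟩ := hB
  have hmeas : ∀ t, Measurable (B t) := fun t => (hadapt t).mono (F.le t) le_rfl
  have hid : ∀ s t : ℝ, 0 ≤ s → s ≤ t → MemLp (fun ω => B t ω - B s ω) 2 P ∧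
      ∫ ω, (B t ω - B s ω) ∂P = 0 ∧ ∫ ω, (B t ω - B s ω) ^ 2 ∂P = t - s := by
    intro s t hs hst
    have hm : Measurable fun ω => B t ω - B s ω := (hmeas t).sub (hmeas s)
    refine ⟨?_, ?_, ?_⟩
    · have h : MemLp id 2 (P.map fun ω => B t ω - B s ω) := by
        rw [hlaw s t hs hst]
        exact memLp_id_gaussianReal' 2 (by simp)
      exact (memLp_map_measure_iff (by fun_prop) hm.aemeasurable).1 h
    · have h := integral_map (μ := P) hm.aemeasurable (f := fun x : ℝ => x) (by fun_prop)
      rw [hlaw s t hs hst, integral_id_gaussianReal] at h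
      exact h.symm
    · have h := integral_map (μ := P) hm.aemeasurable (f := fun x : ℝ => x ^ 2) (by fun_prop)
      rw [hlaw s t hs hst] at h
      rw [← h]
      have h2 := variance_of_integral_eq_zero (X := fun x : ℝ => x)
        (μ := gaussianReal 0 (t - s).toNNReal) (by fun_prop) (by simp)
      rw [variance_fun_id_gaussianReal] at h2
      rw [← h2, Real.coe_toNNReal _ (by linarith)]
  have hB0 : ∀ t, B t = fun ω => B t ω - B 0 ω := fun t => by ext ω; simp [hzero ω]
  have hL2 : ∀ t, 0 ≤ t → MemLp (B t) 2 P := fun t ht => by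
    rw [hB0 t]; exact (hid 0 t le_rfl ht).1
  have hmean : ∀ t, 0 ≤ t → ∫ ω, B t ω ∂P = 0 := fun t ht => by
    rw [hB0 t]; exact (hid 0 t le_rfl ht).2.1
  refine ⟨hmeas, hcont, hL2, hmean, fun s t hs hst => ?_⟩
  have hm : Measurable fun ω => B t ω - B s ω := (hmeas t).sub (hmeas s)
  have hind : IndepFun (B s) (fun ω => B t ω - B s ω) P := by
    rw [IndepFun_iff_Indep]
    exact indep_of_indep_of_le_left (hindep s t hs hst).symm (hadapt s).comap_le
  have h1 : ∫ ω, B s ω * (B t ω - B s ω) ∂P = 0 := by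
    rw [hind.integral_fun_mul_eq_mul_integral (hmeas s).aestronglyMeasurable
      hm.aestronglyMeasurable, hmean s hs, zero_mul]
  have h2 : ∫ ω, B s ω ^ 2 ∂P = s := by
    have := (hid 0 s le_rfl hs).2.2
    simpa [hzero] using this
  have h3 : ∀ ω, B s ω * B t ω = B s ω * (B t ω - B s ω) + B s ω ^ 2 := fun ω => by ring
  simp only [h3]
  rw [integral_add (integrable_fun_mul_of_memLp_two (hL2 s hs) (hid s t hs hst).1)
    (hL2 s hs).integrable_sq, h1, h2, zero_add]

lemma measurable_intervalIntegral_of_continuous {Y : ℝ → Ω → ℝ} (hY : ∀ t, Measurable (Y t))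
    (hc : ∀ ω, Continuous fun t => Y t ω) (α β : ℝ) :
    Measurable fun ω => ∫ s in α..β, Y s ω := by
  have h : StronglyMeasurable (Function.uncurry Y) :=
    (measurable_uncurry_of_continuous_of_measurable hc hY).stronglyMeasurable
  simp only [intervalIntegral]
  exact (h.integral_prod_left.measurable).sub (h.integral_prod_left.measurable)

lemma integral_intervalIntegral_swap_of_bound [IsFiniteMeasure P] {Y : ℝ → Ω → ℝ}
    (hY : ∀ t, Measurable (Y t)) (hc : ∀ ω, Continuous fun t => Y t ω) {α β C : ℝ} (hαβ : α ≤ β)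
    (hint : ∀ s ∈ Icc α β, Integrable (Y s) P) (hbd : ∀ s ∈ Icc α β, ∫ ω, |Y s ω| ∂P ≤ C) :
    Integrable (fun ω => ∫ s in α..β, Y s ω) P ∧
      ∫ ω, (∫ s in α..β, Y s ω) ∂P = ∫ s in α..β, ∫ ω, Y s ω ∂P := by
  have hm : Measurable (Function.uncurry Y) :=
    measurable_uncurry_of_continuous_of_measurable hc hY
  have hI : Integrable (Function.uncurry Y) ((volume.restrict (uIoc α β)).prod P) := by
    rw [integrable_prod_iff hm.aestronglyMeasurable, uIoc_of_le hαβ]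
    refine ⟨?_, ?_⟩
    · filter_upwards [ae_restrict_mem measurableSet_Ioc] with s hs
      exact hint s (Ioc_subset_Icc_self hs)
    · refine Integrable.of_bound (C := C)
        hm.norm.stronglyMeasurable.integral_prod_right'.aestronglyMeasurable ?_
      filter_upwards [ae_restrict_mem measurableSet_Ioc] with s hs
      rw [Real.norm_of_nonneg (integral_nonneg fun _ => norm_nonneg _)]
      exact hbd s (Ioc_subset_Icc_self hs)
  refine ⟨?_, (intervalIntegral_integral_swap hI).symm⟩
  simp only [intervalIntegral.integral_of_le hαβ]
  rw [uIoc_of_le hαβ] at hI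
  exact hI.integral_prod_right

namespace HasBrownianMoments

variable {B : ℝ → Ω → ℝ}

lemma integral_sq (h : HasBrownianMoments P B) {t : ℝ} (ht : 0 ≤ t) :
    ∫ ω, B t ω ^ 2 ∂P = t := by
  simpa only [sq] using h.integral_mul t t ht le_rfl

lemma memLp_integral_abs [IsFiniteMeasure P] (h : HasBrownianMoments P B) {T : ℝ} (hT : 0 < T) :
    MemLp (fun ω => ∫ s in (0:ℝ)..T, |B s ω|) 2 P := by
  have hm : Measurable fun ω => ∫ s in (0:ℝ)..T, |B s ω| :=
    measurable_intervalIntegral_of_continuous (fun t => (h.measurable t).abs)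
      (fun ω => (h.continuous ω).abs) 0 T
  have hsq := (integral_intervalIntegral_swap_of_bound (P := P) (Y := fun s ω => B s ω ^ 2) (C := T)
    (fun t => (h.measurable t).pow_const 2) (fun ω => (h.continuous ω).pow 2) hT.le
    (fun s hs => (h.memLp s hs.1).integrable_sq)
    (fun s hs => by simpa [abs_of_nonneg, sq_nonneg, h.integral_sq hs.1] using hs.2)).1
  rw [memLp_two_iff_integrable_sq hm.aestronglyMeasurable]
  refine (hsq.const_mul T).mono' (hm.pow_const 2).aestronglyMeasurable
    (Eventually.of_forall fun ω => ?_)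
  rw [Real.norm_of_nonneg (sq_nonneg _)]
  set D := ∫ s in (0:ℝ)..T, |B s ω|
  have hcB := h.continuous ω
  have h1 : 0 ≤ ∫ s in (0:ℝ)..T, (|B s ω| - D / T) ^ 2 :=
    intervalIntegral.integral_nonneg hT.le fun _ _ => sq_nonneg _
  have h2 : ∀ s, (|B s ω| - D / T) ^ 2
      = B s ω ^ 2 - 2 * (D / T) * |B s ω| + (D / T) ^ 2 := fun s => by
    rw [← sq_abs (B s ω)]; ring
  simp only [h2] at h1
  rw [intervalIntegral.integral_add (by apply Continuous.intervalIntegrable; fun_prop) (by simp),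
    intervalIntegral.integral_sub (by apply Continuous.intervalIntegrable; fun_prop)
      (by apply Continuous.intervalIntegrable; fun_prop),
    intervalIntegral.integral_const_mul, intervalIntegral.integral_const] at h1
  have h3 : T * ((∫ s in (0:ℝ)..T, B s ω ^ 2) - 2 * (D / T) * D + (T - 0) • (D / T) ^ 2)
      = T * (∫ s in (0:ℝ)..T, B s ω ^ 2) - D ^ 2 := by
    simp only [sub_zero, smul_eq_mul]
    field_simp
    ring
  have h4 := mul_nonneg hT.le h1
  rw [h3] at h4
  linarith

lemma measurable_ouPrimitive (h : HasBrownianMoments P B) (a σ t : ℝ) :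
    Measurable fun ω => ouPrimitive a σ (fun s => B s ω) t :=
  (measurable_intervalIntegral_of_continuous (fun s => (h.measurable s).const_mul _)
    (fun ω => by have := h.continuous ω; fun_prop) 0 t).const_mul _

lemma memLp_ouPrimitive [IsFiniteMeasure P] (h : HasBrownianMoments P B) {a : ℝ} (ha : a < 0)
    (σ : ℝ) {t : ℝ} (ht : 0 ≤ t) :
    MemLp (fun ω => ouPrimitive a σ (fun s => B s ω) t) 2 P := by
  refine ((h.memLp_integral_abs (T := t + 1) (by linarith)).const_mul |σ|).mono'
    (h.measurable_ouPrimitive a σ t).aestronglyMeasurable (Eventually.of_forall fun ω => ?_)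
  exact abs_ouPrimitive_le ha (h.continuous ω) ht (by linarith)

lemma integral_mul_intervalIntegral [IsFiniteMeasure P] (h : HasBrownianMoments P B) (a : ℝ)
    {Z : Ω → ℝ} (hZm : Measurable Z) (hZ : MemLp Z 2 P) {α β : ℝ} (hα : 0 ≤ α) (hαβ : α ≤ β) :
    Integrable (fun ω => Z ω * ∫ s in α..β, exp (-(a * s)) * B s ω) P ∧
      ∫ ω, Z ω * (∫ s in α..β, exp (-(a * s)) * B s ω) ∂P
        = ∫ s in α..β, exp (-(a * s)) * ∫ ω, Z ω * B s ω ∂P := by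
  have hint : ∀ s ∈ Icc α β, Integrable (fun ω => exp (-(a * s)) * (Z ω * B s ω)) P := fun s hs =>
    (hZ.integrable_mul (h.memLp s (hα.trans hs.1))).const_mul _
  have hswap := (integral_intervalIntegral_swap_of_bound (P := P)
    (Y := fun s ω => exp (-(a * s)) * (Z ω * B s ω))
    (C := exp (|a| * β) * ((β + ∫ ω, Z ω ^ 2 ∂P) / 2))
    (fun t => (hZm.mul (h.measurable t)).const_mul _)
    (fun ω => by have := h.continuous ω; fun_prop) hαβ hint (fun s hs => ?_))
  · have hpath : (fun ω => ∫ s in α..β, exp (-(a * s)) * (Z ω * B s ω))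
        = fun ω => Z ω * ∫ s in α..β, exp (-(a * s)) * B s ω := by
      ext ω
      rw [← intervalIntegral.integral_const_mul]
      congr 1
      ext s
      ring
    simpa only [integral_const_mul, hpath] using hswap
  · have hs0 := hα.trans hs.1
    simp only [abs_mul, abs_exp]
    rw [integral_const_mul]
    have h1 := two_mul_abs_integral_mul_le (hZ.abs) (h.memLp s hs0).abs one_pos
    simp only [Pi.abs_apply, sq_abs, one_mul, inv_one, h.integral_sq hs0] at h1
    have h2 := le_abs_self (∫ ω, |Z ω| * |B s ω| ∂P)
    have h3 : 0 ≤ ∫ ω, |Z ω| * |B s ω| ∂P := integral_nonneg fun ω => by positivity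
    gcongr
    · have : -(a * s) ≤ |a| * s := by nlinarith [neg_le_abs a]
      exact this.trans (mul_le_mul_of_nonneg_left hs.2 (abs_nonneg a))
    · linarith [hs.2]

end HasBrownianMoments

end Moments

section OrnsteinUhlenbeck

variable {Ω : Type*} {mΩ : MeasurableSpace Ω} {P : Measure Ω} {B : ℝ → Ω → ℝ}

namespace HasBrownianMoments

lemma integral_mul_ouPrimitive [IsFiniteMeasure P] (h : HasBrownianMoments P B) (a σ : ℝ)
    {Z : Ω → ℝ} (hZm : Measurable Z) (hZ : MemLp Z 2 P) {t : ℝ} (ht : 0 ≤ t) :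
    ∫ ω, Z ω * ouPrimitive a σ (fun s => B s ω) t ∂P
      = σ * exp (a * t) * ∫ s in (0:ℝ)..t, exp (-(a * s)) * ∫ ω, Z ω * B s ω ∂P := by
  rw [← (h.integral_mul_intervalIntegral a hZm hZ le_rfl ht).2, ← integral_const_mul]
  congr 1
  ext ω
  simp only [ouPrimitive]
  ring

lemma integral_ouPrimitive [IsFiniteMeasure P] (h : HasBrownianMoments P B) (a σ : ℝ)
    {t : ℝ} (ht : 0 ≤ t) : ∫ ω, ouPrimitive a σ (fun s => B s ω) t ∂P = 0 := by
  have h1 := h.integral_mul_ouPrimitive a σ (Z := fun _ => 1) measurable_const (memLp_const 1) ht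
  have h2 : ∫ s in (0:ℝ)..t, exp (-(a * s)) * ∫ ω, 1 * B s ω ∂P = ∫ s in (0:ℝ)..t, (0:ℝ) := by
    refine intervalIntegral.integral_congr fun s hs => ?_
    rw [uIcc_of_le ht] at hs
    simp [h.integral_eq_zero s hs.1]
  rw [h2] at h1
  simpa using h1

lemma integral_mul_ouPrimitive_of_le [IsFiniteMeasure P] (h : HasBrownianMoments P B) {a : ℝ}
    (ha : a < 0) (σ : ℝ) {t u : ℝ} (ht : 0 ≤ t) (htu : t ≤ u) :
    ∫ ω, B u ω * ouPrimitive a σ (fun s => B s ω) t ∂P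
      = σ * (exp (a * t) - 1 - a * t) / a ^ 2 := by
  have ha' : a ≠ 0 := ha.ne
  rw [h.integral_mul_ouPrimitive a σ (h.measurable u) (h.memLp u (ht.trans htu)) ht]
  have h1 : ∫ s in (0:ℝ)..t, exp (-(a * s)) * ∫ ω, B u ω * B s ω ∂P
      = ∫ s in (0:ℝ)..t, exp (-(a * s)) * s := by
    refine intervalIntegral.integral_congr fun s hs => ?_
    rw [uIcc_of_le ht] at hs
    simp only [mul_comm (B u _), h.integral_mul s u hs.1 (hs.2.trans htu)]
  have h2 : ∀ s : ℝ, HasDerivAt (fun s => -(1 + a * s) * exp (-(a * s)) / a ^ 2)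
      (exp (-(a * s)) * s) s := fun s => by
    have h3 : HasDerivAt (fun s : ℝ => a * s) a s := by simpa using (hasDerivAt_id s).const_mul a
    refine (((h3.const_add 1).neg.mul h3.neg.exp).div_const (a ^ 2)).congr_deriv ?_
    simp only [Pi.neg_apply]
    field_simp
    ring
  have h4 := intervalIntegral.integral_eq_sub_of_hasDerivAt (a := 0) (b := t) (fun s _ => h2 s)
    (by apply Continuous.intervalIntegrable; fun_prop)
  have h5 : exp (a * t) * exp (-(a * t)) = 1 := by rw [← exp_add]; simp
  rw [h1, h4]
  simp only [mul_zero, neg_zero, exp_zero, add_zero]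
  linear_combination (-σ * (1 + a * t) / a ^ 2) * h5

lemma integral_ouPrimitive_sq [IsFiniteMeasure P] (h : HasBrownianMoments P B) {a : ℝ}
    (ha : a < 0) (σ : ℝ) {t : ℝ} (ht : 0 ≤ t) :
    ∫ ω, ouPrimitive a σ (fun s => B s ω) t ^ 2 ∂P
      = (σ ^ 2 * (exp (a * t) ^ 2 - 1) / (2 * a) - 2 * σ ^ 2 * (exp (a * t) - 1 - a * t) / a
        - σ ^ 2 * t) / a ^ 2 := by
  have ha' : a ≠ 0 := ha.ne
  have hN : ∀ ω, Continuous (ouPrimitive a σ fun s => B s ω) := fun ω =>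
    continuous_ouPrimitive (h.continuous ω)
  have hlin : ∀ s : ℝ, HasDerivAt (fun s : ℝ => a * s) a s := fun s => by
    simpa using (hasDerivAt_id s).const_mul a
  have hexp : ∀ s : ℝ, exp (a * s) * exp (-(a * s)) = 1 := fun s => by rw [← exp_add]; simp
  have hpath : ∀ ω, ouPrimitive a σ (fun s => B s ω) t ^ 2 = exp (a * t) ^ 2 * ∫ s in (0:ℝ)..t,
      exp (-(a * s)) ^ 2 * (2 * σ) * (B s ω * ouPrimitive a σ (fun s => B s ω) s) := by
    intro ω
    have hd : ∀ s : ℝ, HasDerivAt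
        (fun s => exp (-(a * s)) ^ 2 * ouPrimitive a σ (fun s => B s ω) s ^ 2)
        (exp (-(a * s)) ^ 2 * (2 * σ) * (B s ω * ouPrimitive a σ (fun s => B s ω) s)) s := by
      intro s
      refine (((hlin s).neg.exp.pow 2).mul
        ((hasDerivAt_ouPrimitive (h.continuous ω) s).pow 2)).congr_deriv ?_
      simp only [Pi.pow_apply, Pi.neg_apply]
      push_cast
      ring
    have hBc := h.continuous ω
    have hNc := hN ω
    rw [intervalIntegral.integral_eq_sub_of_hasDerivAt (fun s _ => hd s)
      (by apply Continuous.intervalIntegrable; fun_prop), ouPrimitive_zero]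
    have h5 : exp (a * t) ^ 2 * exp (-(a * t)) ^ 2 = 1 := by rw [← mul_pow, hexp]; simp
    linear_combination (-ouPrimitive a σ (fun s => B s ω) t ^ 2) * h5
  have hD := h.memLp_integral_abs (T := t + 1) (by linarith)
  have hswap := (integral_intervalIntegral_swap_of_bound (P := P) (Y := fun s ω =>
    exp (-(a * s)) ^ 2 * (2 * σ) * (B s ω * ouPrimitive a σ (fun s => B s ω) s))
    (C := exp (-(a * t)) ^ 2 * (2 * |σ|) *
      ((∫ ω, (|σ| * ∫ s in (0:ℝ)..(t + 1), |B s ω|) ^ 2 ∂P) + t))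
    (fun s => ((h.measurable s).mul (h.measurable_ouPrimitive a σ s)).const_mul _)
    (fun ω => by
      have hBc := h.continuous ω
      have hNc := hN ω
      fun_prop) ht
    (fun s hs => (integrable_fun_mul_of_memLp_two (h.memLp s hs.1)
      (h.memLp_ouPrimitive ha σ hs.1)).const_mul _) (fun s hs => ?_)).2
  · simp only [hpath]
    rw [integral_const_mul, hswap]
    have hcongr : ∫ s in (0:ℝ)..t, ∫ ω, exp (-(a * s)) ^ 2 * (2 * σ) *
          (B s ω * ouPrimitive a σ (fun s => B s ω) s) ∂P
        = ∫ s in (0:ℝ)..t, exp (-(a * s)) ^ 2 * (2 * σ) *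
          (σ * (exp (a * s) - 1 - a * s) / a ^ 2) := by
      refine intervalIntegral.integral_congr fun s hs => ?_
      rw [uIcc_of_le ht] at hs
      rw [integral_const_mul, h.integral_mul_ouPrimitive_of_le ha σ hs.1 le_rfl]
    have hV : ∀ s : ℝ, HasDerivAt (fun s => exp (-(a * s)) ^ 2 *
        ((σ ^ 2 * (exp (a * s) ^ 2 - 1) / (2 * a) - 2 * σ ^ 2 * (exp (a * s) - 1 - a * s) / a
          - σ ^ 2 * s) / a ^ 2))
        (exp (-(a * s)) ^ 2 * (2 * σ) * (σ * (exp (a * s) - 1 - a * s) / a ^ 2)) s := by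
      intro s
      refine (((hlin s).neg.exp.pow 2).mul
        ((((((hlin s).exp.pow 2).sub_const 1).const_mul (σ ^ 2)).div_const (2 * a)).sub
          ((((((hlin s).exp.sub_const 1).sub (hlin s)).const_mul (2 * σ ^ 2)).div_const a))
          |>.sub ((hasDerivAt_id s).const_mul (σ ^ 2)) |>.div_const (a ^ 2))).congr_deriv ?_
      simp only [Pi.pow_apply, Pi.neg_apply, Pi.sub_apply, id]
      push_cast
      field_simp
      ring
    rw [hcongr, intervalIntegral.integral_eq_sub_of_hasDerivAt (fun s _ => hV s)
      (by apply Continuous.intervalIntegrable; fun_prop)]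
    have h5 : exp (a * t) ^ 2 * exp (-(a * t)) ^ 2 = 1 := by rw [← mul_pow, hexp]; simp
    simp only [mul_zero, neg_zero, exp_zero, one_pow, sub_self, zero_div, sub_zero]
    rw [← mul_assoc, h5, one_mul]
  · simp only [abs_mul, abs_pow, abs_exp, abs_two]
    rw [integral_const_mul]
    have hB2 := h.integral_sq hs.1
    have hle : ∫ ω, |B s ω| * |ouPrimitive a σ (fun s => B s ω) s| ∂P
        ≤ ∫ ω, (|σ| * ∫ s in (0:ℝ)..(t + 1), |B s ω|) ^ 2 + B s ω ^ 2 ∂P := by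
      refine integral_mono (integrable_fun_mul_of_memLp_two (h.memLp s hs.1).abs
        (h.memLp_ouPrimitive ha σ hs.1).abs)
        ((hD.const_mul |σ|).integrable_sq.add (h.memLp s hs.1).integrable_sq) fun ω => ?_
      have h1 := abs_ouPrimitive_le (σ := σ) (T := t + 1) ha (h.continuous ω) hs.1
        (by linarith [hs.2])
      simp only
      nlinarith [abs_nonneg (ouPrimitive a σ (fun s => B s ω) s), abs_nonneg (B s ω),
        sq_abs (B s ω), sq_nonneg (|B s ω| - |ouPrimitive a σ (fun s => B s ω) s|)]
    rw [integral_add (hD.const_mul |σ|).integrable_sq (h.memLp s hs.1).integrable_sq, hB2] at hle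
    have h0 : 0 ≤ ∫ ω, |B s ω| * |ouPrimitive a σ (fun s => B s ω) s| ∂P :=
      integral_nonneg fun ω => by positivity
    have he : exp (-(a * s)) ≤ exp (-(a * t)) := exp_le_exp.2 (by nlinarith [hs.2])
    refine mul_le_mul ?_ (hle.trans (by linarith [hs.2])) h0 (by positivity)
    exact mul_le_mul_of_nonneg_right (pow_le_pow_left₀ (exp_nonneg _) he 2) (by positivity)

lemma integral_ouPrimitive_sq_le [IsFiniteMeasure P] (h : HasBrownianMoments P B) {a : ℝ}
    (ha : a < 0) (σ : ℝ) {t : ℝ} (ht : 0 ≤ t) :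
    ∫ ω, ouPrimitive a σ (fun s => B s ω) t ^ 2 ∂P
      ≤ σ ^ 2 * (1 / (2 * -a) + 1) / a ^ 2 * (1 + t) := by
  have ha' : a ≠ 0 := ha.ne
  rw [h.integral_ouPrimitive_sq ha σ ht, div_mul_eq_mul_div]
  have hna : 0 < -a := by linarith
  have hinv : 0 < 1 / (-a) := by positivity
  have he : exp (a * t) ≤ 1 := exp_le_one_iff.2 (mul_nonpos_of_nonpos_of_nonneg ha.le ht)
  have hs := sq_nonneg σ
  have h1 : σ ^ 2 * (exp (a * t) ^ 2 - 1) / (2 * a) - 2 * σ ^ 2 * (exp (a * t) - 1 - a * t) / a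
        - σ ^ 2 * t = σ ^ 2 * (1 / (2 * -a) + t - 2 * (1 / -a) * (1 - exp (a * t))
          - 1 / (2 * -a) * exp (a * t) ^ 2) := by
    field_simp
    ring
  rw [h1, mul_assoc (σ ^ 2)]
  have hinv2 : 0 < 1 / (2 * -a) := by positivity
  have h2 : 0 ≤ 1 / (2 * -a) * exp (a * t) ^ 2 := by positivity
  have h3 : 0 ≤ 2 * (1 / -a) * (1 - exp (a * t)) := mul_nonneg (by positivity) (by linarith)
  have h4 : 0 ≤ 1 / (2 * -a) * t := by positivity
  gcongr
  linarith

lemma integral_ou_mul_ou [IsFiniteMeasure P] (h : HasBrownianMoments P B) {a : ℝ}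
    (ha : a < 0) (σ : ℝ) {t Δ : ℝ} (ht : 0 ≤ t) (hΔ : 0 ≤ Δ) :
    ∫ ω, (a * ouPrimitive a σ (fun s => B s ω) t + σ * B t ω) *
        (a * ouPrimitive a σ (fun s => B s ω) (t + Δ) + σ * B (t + Δ) ω) ∂P
      = exp (a * Δ) * (σ ^ 2 * (exp (a * t) ^ 2 - 1) / (2 * a)) := by
  have ha' : a ≠ 0 := ha.ne
  set N : ℝ → Ω → ℝ := fun t ω => ouPrimitive a σ (fun s => B s ω) t with hNdef
  set U : Ω → ℝ := fun ω => a * N t ω + σ * B t ω with hU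
  have hNL : MemLp (N t) 2 P := h.memLp_ouPrimitive ha σ ht
  have hBL := h.memLp t ht
  have hUm : Measurable U :=
    ((h.measurable_ouPrimitive a σ t).const_mul a).add ((h.measurable t).const_mul σ)
  have hUL : MemLp U 2 P := (hNL.const_mul a).add (hBL.const_mul σ)
  have hexp : ∀ s : ℝ, exp (a * s) * exp (-(a * s)) = 1 := fun s => by rw [← exp_add]; simp
  set ρ := σ * (exp (a * t) - 1) / a with hρ
  have hUB : ∀ s, t ≤ s → ∫ ω, U ω * B s ω ∂P = ρ := by
    intro s hs
    have hBs := h.memLp s (ht.trans hs)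
    have h1 : ∀ ω, U ω * B s ω = a * (B s ω * N t ω) + σ * (B t ω * B s ω) := fun ω => by
      simp only [hU]; ring
    simp only [h1]
    rw [integral_add ((integrable_fun_mul_of_memLp_two hBs hNL).const_mul a)
      ((integrable_fun_mul_of_memLp_two hBL hBs).const_mul σ), integral_const_mul,
      integral_const_mul, h.integral_mul_ouPrimitive_of_le ha σ ht hs, h.integral_mul t s ht hs, hρ]
    field_simp
    ring
  have hUU : ∫ ω, U ω * U ω ∂P = σ ^ 2 * (exp (a * t) ^ 2 - 1) / (2 * a) := by
    have h1 : ∀ ω, U ω * U ω = a ^ 2 * N t ω ^ 2 + 2 * a * σ * (B t ω * N t ω)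
        + σ ^ 2 * B t ω ^ 2 := fun ω => by simp only [hU]; ring
    simp only [h1]
    have i1 := hNL.integrable_sq.const_mul (a ^ 2)
    have i2 := (integrable_fun_mul_of_memLp_two hBL hNL).const_mul (2 * a * σ)
    have i12 : Integrable (fun ω => a ^ 2 * N t ω ^ 2 + 2 * a * σ * (B t ω * N t ω)) P := i1.add i2
    rw [integral_add i12 (hBL.integrable_sq.const_mul _), integral_add i1 i2,
      integral_const_mul, integral_const_mul, integral_const_mul, h.integral_sq ht,
      h.integral_mul_ouPrimitive_of_le ha σ ht le_rfl, h.integral_ouPrimitive_sq ha σ ht]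
    field_simp
    ring
  have hUN : ∫ ω, U ω * N t ω ∂P = (σ ^ 2 * (exp (a * t) ^ 2 - 1) / (2 * a) - σ * ρ) / a := by
    have h1 : ∫ ω, U ω * U ω ∂P = a * (∫ ω, U ω * N t ω ∂P) + σ * ∫ ω, U ω * B t ω ∂P := by
      rw [← integral_const_mul, ← integral_const_mul, ← integral_add
        ((integrable_fun_mul_of_memLp_two hUL hNL).const_mul a)
        ((integrable_fun_mul_of_memLp_two hUL hBL).const_mul σ)]
      congr 1
      ext ω
      simp only [hU]
      ring
    rw [hUU, hUB t le_rfl] at h1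
    rw [h1, add_sub_cancel_right, mul_div_cancel_left₀ _ ha.ne]
  have hint : ∫ ω, U ω * (∫ s in t..(t + Δ), exp (-(a * s)) * B s ω) ∂P
      = ρ * ((exp (-(a * t)) - exp (-(a * (t + Δ)))) / a) := by
    rw [(h.integral_mul_intervalIntegral a hUm hUL ht (by linarith)).2]
    have h1 : ∫ s in t..(t + Δ), exp (-(a * s)) * ∫ ω, U ω * B s ω ∂P
        = ∫ s in t..(t + Δ), exp (-(a * s)) * ρ := by
      refine intervalIntegral.integral_congr fun s hs => ?_
      rw [uIcc_of_le (by linarith)] at hs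
      simp only [hUB s hs.1]
    have h2 : ∀ s : ℝ, HasDerivAt (fun s => -exp (-(a * s)) / a * ρ) (exp (-(a * s)) * ρ) s := by
      intro s
      have h3 : HasDerivAt (fun s : ℝ => a * s) a s := by simpa using (hasDerivAt_id s).const_mul a
      refine ((h3.neg.exp.neg.div_const a).mul_const ρ).congr_deriv ?_
      simp only [Pi.neg_apply]
      field_simp
    rw [h1, intervalIntegral.integral_eq_sub_of_hasDerivAt (fun s _ => h2 s)
      (by apply Continuous.intervalIntegrable; fun_prop)]
    field_simp
    ring
  have hIL : Integrable (fun ω => U ω * ∫ s in t..(t + Δ), exp (-(a * s)) * B s ω) P :=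
    (h.integral_mul_intervalIntegral a hUm hUL ht (by linarith)).1
  have hsplit : ∀ ω, U ω * (a * N (t + Δ) ω + σ * B (t + Δ) ω)
      = a * exp (a * Δ) * (U ω * N t ω)
        + a * σ * exp (a * (t + Δ)) * (U ω * ∫ s in t..(t + Δ), exp (-(a * s)) * B s ω)
        + σ * (U ω * B (t + Δ) ω) := fun ω => by
    have h2 := ouPrimitive_eq_add (a := a) (σ := σ) (h.continuous ω) t (t + Δ)
    rw [add_sub_cancel_left] at h2
    simp only [hNdef, h2]
    ring
  have i1 := (integrable_fun_mul_of_memLp_two hUL hNL).const_mul (a * exp (a * Δ))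
  have i2 := hIL.const_mul (a * σ * exp (a * (t + Δ)))
  have i3 := (integrable_fun_mul_of_memLp_two hUL (h.memLp (t + Δ) (by linarith))).const_mul σ
  change ∫ ω, U ω * (a * N (t + Δ) ω + σ * B (t + Δ) ω) ∂P = _
  simp only [hsplit]
  have i12 : Integrable (fun ω => a * exp (a * Δ) * (U ω * N t ω) + a * σ * exp (a * (t + Δ)) *
    (U ω * ∫ s in t..(t + Δ), exp (-(a * s)) * B s ω)) P := i1.add i2
  rw [integral_add i12 i3, integral_add i1 i2, integral_const_mul, integral_const_mul,
    integral_const_mul, hUN, hint, hUB (t + Δ) (by linarith)]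
  have h5 : exp (a * (t + Δ)) * exp (-(a * t)) = exp (a * Δ) := by rw [← exp_add]; ring_nf
  have h6 := hexp (t + Δ)
  have h7 : a * ((exp (-(a * t)) - exp (-(a * (t + Δ)))) / a)
      = exp (-(a * t)) - exp (-(a * (t + Δ))) := mul_div_cancel₀ _ ha'
  have h8 : a * ((σ ^ 2 * (exp (a * t) ^ 2 - 1) / (2 * a) - σ * ρ) / a)
      = σ ^ 2 * (exp (a * t) ^ 2 - 1) / (2 * a) - σ * ρ := mul_div_cancel₀ _ ha'
  linear_combination exp (a * Δ) * h8 + σ * exp (a * (t + Δ)) * ρ * h7 + σ * ρ * h5 - σ * ρ * h6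

end HasBrownianMoments

end OrnsteinUhlenbeck

section SecondMoments

variable {Ω : Type*} {mΩ : MeasurableSpace Ω} {P : Measure Ω}

lemma hasDerivAt_integral_sq {f f' : ℝ → Ω → ℝ} {T : ℝ} {G₁ G₂ : Ω → ℝ}
    (hf : ∀ t, Measurable (f t)) (hf' : ∀ t, Measurable (f' t))
    (hG₁ : MemLp G₁ 2 P) (hG₂ : MemLp G₂ 2 P)
    (hpath : ∀ᵐ ω ∂P, ∀ t ∈ Ioo 0 T, HasDerivAt (fun t => f t ω) (f' t ω) t ∧
      |f t ω| ≤ G₁ ω ∧ |f' t ω| ≤ G₂ ω) {t : ℝ} (ht : t ∈ Ioo 0 T) :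
    HasDerivAt (fun t => ∫ ω, f t ω ^ 2 ∂P) (2 * ∫ ω, f t ω * f' t ω ∂P) t := by
  have hft : MemLp (f t) 2 P := hG₁.mono' (hf t).aestronglyMeasurable
    (hpath.mono fun ω h => (h t ht).2.1)
  have h := (hasDerivAt_integral_of_dominated_loc_of_deriv_le (μ := P) (𝕜 := ℝ)
    (F := fun t ω => f t ω ^ 2) (F' := fun t ω => 2 * (f t ω * f' t ω))
    (bound := fun ω => 2 * (G₁ ω * G₂ ω)) (Ioo_mem_nhds ht.1 ht.2)
    (Eventually.of_forall fun s => ((hf s).pow_const 2).aestronglyMeasurable)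
    hft.integrable_sq (((hf t).mul (hf' t)).const_mul 2).aestronglyMeasurable
    (hpath.mono fun ω h s hs => ?_)
    ((integrable_fun_mul_of_memLp_two hG₁ hG₂).const_mul 2)
    (hpath.mono fun ω h s hs => ?_)).2
  · rwa [integral_const_mul] at h
  · obtain ⟨-, h1, h2⟩ := h s hs
    rw [Real.norm_eq_abs, abs_mul, abs_mul, abs_two]
    gcongr
    exact (abs_nonneg _).trans h1
  · refine ((h s hs).1.pow 2).congr_deriv ?_
    push_cast
    ring

lemma tendsto_integral_residual_sq {a b C : ℝ} (ha : a < 0) (hab : a + b < 0)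
    {N J R : ℝ → Ω → ℝ} (hN : ∀ t, Measurable (N t)) (hJ : ∀ t, Measurable (J t))
    (hR : ∀ t, Measurable (R t))
    (hdom : ∀ T, 0 < T → ∃ G : Ω → ℝ, MemLp G 2 P ∧ ∀ᵐ ω ∂P, ∀ t ∈ Icc 0 T,
      |N t ω| ≤ G ω ∧ |J t ω| ≤ G ω ∧ |R t ω| ≤ G ω)
    (hderiv : ∀ᵐ ω ∂P, ∀ t, 0 ≤ t → HasDerivAt (fun t => J t ω) (R t ω) t ∧
      HasDerivAt (fun t => R t ω) (a * R t ω + b * ((J t ω + N t ω) / (1 + t))) t)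
    (hNsq : ∀ t, 0 ≤ t → ∫ ω, N t ω ^ 2 ∂P ≤ C * (1 + t)) :
    Tendsto (fun t => ∫ ω, R t ω ^ 2 ∂P) atTop (nhds 0) := by
  set β := b / a with hβ
  have haβ : a * β = b := mul_div_cancel₀ _ ha.ne
  have hβ1 : 0 < 1 + β := by
    by_contra! h
    nlinarith [mul_nonneg_of_nonpos_of_nonpos ha.le h]
  set Q : ℝ → Ω → ℝ := fun t ω => J t ω / (1 + t) with hQ
  set n : ℝ → Ω → ℝ := fun t ω => N t ω / (1 + t) with hn
  set y : ℝ → Ω → ℝ := fun t ω => R t ω + β * Q t ω with hy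
  have hQm : ∀ t, Measurable (Q t) := fun t => (hJ t).div_const _
  have hnm : ∀ t, Measurable (n t) := fun t => (hN t).div_const _
  have hym : ∀ t, Measurable (y t) := fun t => (hR t).add ((hQm t).const_mul β)
  set Q' : ℝ → Ω → ℝ := fun t ω => 1 / (1 + t) * (y t ω - (1 + β) * Q t ω) with hQ'
  set y' : ℝ → Ω → ℝ := fun t ω => a * y t ω + b * n t ω + β * Q' t ω with hy'
  have hQ'm : ∀ t, Measurable (Q' t) := fun t =>
    ((hym t).sub ((hQm t).const_mul _)).const_mul _
  have hy'm : ∀ t, Measurable (y' t) := fun t =>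
    (((hym t).const_mul a).add ((hnm t).const_mul b)).add ((hQ'm t).const_mul β)
  have hbd : ∀ T, 0 < T → ∃ G : Ω → ℝ, MemLp G 2 P ∧ ∀ᵐ ω ∂P, ∀ t ∈ Ioo 0 T,
      (HasDerivAt (fun t => Q t ω) (Q' t ω) t ∧ |Q t ω| ≤ G ω ∧ |Q' t ω| ≤ 2 * G ω) ∧
      (HasDerivAt (fun t => y t ω) (y' t ω) t ∧ |y t ω| ≤ (1 + |β|) * G ω ∧
        |y' t ω| ≤ (|a| + 2 * |b| + 2 * |β|) * G ω) ∧ |n t ω| ≤ G ω := by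
    intro T hT
    obtain ⟨G, hG, hbd⟩ := hdom T hT
    refine ⟨G, hG, ?_⟩
    filter_upwards [hbd, hderiv] with ω hbd hderiv t ht
    obtain ⟨hNb, hJb, hRb⟩ := hbd t ⟨ht.1.le, ht.2.le⟩
    obtain ⟨hJd, hRd⟩ := hderiv t ht.1.le
    have ht1 : 1 ≤ 1 + t := by linarith [ht.1]
    have ht0 : (1 + t) ≠ 0 := by positivity
    have hdiv : ∀ z : ℝ, |z| ≤ G ω → |z / (1 + t)| ≤ G ω := fun z hz => by
      rw [abs_div, abs_of_pos (by linarith : 0 < 1 + t)]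
      exact (div_le_self (abs_nonneg z) ht1).trans hz
    have hQb : |Q t ω| ≤ G ω := hdiv _ hJb
    have hnb : |n t ω| ≤ G ω := hdiv _ hNb
    have hQ'eq : Q' t ω = R t ω / (1 + t) - Q t ω / (1 + t) := by
      simp only [hQ', hy]
      ring
    have hQ'b : |Q' t ω| ≤ 2 * G ω := by
      rw [hQ'eq]
      linarith [abs_sub (R t ω / (1 + t)) (Q t ω / (1 + t)), hdiv _ hRb, hdiv _ hQb]
    have hQd : HasDerivAt (fun t => Q t ω) (Q' t ω) t := by
      refine (hJd.div ((hasDerivAt_id t).const_add 1) ht0).congr_deriv ?_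
      rw [hQ'eq]
      simp only [hQ, id]
      field_simp
    have hy'eq : y' t ω = a * R t ω + (b * Q t ω + (b * n t ω + β * Q' t ω)) := by
      simp only [hy', hy]
      linear_combination Q t ω * haβ
    refine ⟨⟨hQd, hQb, hQ'b⟩, ⟨?_, ?_, ?_⟩, hnb⟩
    · refine (hRd.add (hQd.const_mul β)).congr_deriv ?_
      rw [hy'eq]
      simp only [hQ, hn]
      ring
    · calc |y t ω| ≤ |R t ω| + |β * Q t ω| := abs_add_le _ _
        _ = |R t ω| + |β| * |Q t ω| := by rw [abs_mul]
        _ ≤ G ω + |β| * G ω := by gcongr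
        _ = _ := by ring
    · rw [hy'eq]
      calc _ ≤ |a * R t ω| + (|b * Q t ω| + (|b * n t ω| + |β * Q' t ω|)) :=
            (abs_add_le _ _).trans (add_le_add_right ((abs_add_le _ _).trans
              (add_le_add_right (abs_add_le _ _) _)) _)
        _ = |a| * |R t ω| + (|b| * |Q t ω| + (|b| * |n t ω| + |β| * |Q' t ω|)) := by
            simp only [abs_mul]
        _ ≤ |a| * G ω + (|b| * G ω + (|b| * G ω + |β| * (2 * G ω))) := by gcongr
        _ = _ := by ring
  have hL : ∀ t, 0 < t → MemLp (Q t) 2 P ∧ MemLp (y t) 2 P ∧ MemLp (n t) 2 P := by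
    intro t ht
    obtain ⟨G, hG, hbd⟩ := hbd (t + 1) (by linarith)
    have hmem : t ∈ Ioo 0 (t + 1) := ⟨ht, by linarith⟩
    exact ⟨hG.mono' (hQm t).aestronglyMeasurable (hbd.mono fun ω h => (h t hmem).1.2.1),
      (hG.const_mul (1 + |β|)).mono' (hym t).aestronglyMeasurable
        (hbd.mono fun ω h => (h t hmem).2.1.2.1),
      hG.mono' (hnm t).aestronglyMeasurable (hbd.mono fun ω h => (h t hmem).2.2)⟩
  have hlim := moment_system_tendsto_zero (b := b) (C := C) (p := fun t => ∫ ω, y t ω ^ 2 ∂P)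
    (q := fun t => ∫ ω, Q t ω ^ 2 ∂P) (r := fun t => ∫ ω, y t ω * Q t ω ∂P)
    (s := fun t => ∫ ω, n t ω * y t ω ∂P) (e := fun t => ∫ ω, n t ω ^ 2 ∂P) ha hβ1
    (fun t => integral_nonneg fun ω => sq_nonneg _) (fun t => integral_nonneg fun ω => sq_nonneg _)
    (fun t ht l hl => two_mul_abs_integral_mul_le (hL t ht).2.1 (hL t ht).1 hl)
    (fun t ht l hl => two_mul_abs_integral_mul_le (hL t ht).2.2 (hL t ht).2.1 hl)
    (fun t ht => ?_) (fun t ht => ?_) (fun t ht => ?_)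
  · have hup : Tendsto (fun t => 2 * (∫ ω, y t ω ^ 2 ∂P) + 2 * β ^ 2 * ∫ ω, Q t ω ^ 2 ∂P) atTop
        (nhds 0) := by
      simpa using (hlim.1.const_mul 2).add (hlim.2.const_mul (2 * β ^ 2))
    refine tendsto_of_tendsto_of_tendsto_of_le_of_le' tendsto_const_nhds hup
      (Eventually.of_forall fun t => integral_nonneg fun ω => sq_nonneg _) ?_
    filter_upwards [eventually_gt_atTop 0] with t ht
    obtain ⟨hQL, hyL, -⟩ := hL t ht
    rw [← integral_const_mul, ← integral_const_mul, ← integral_add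
      (hyL.integrable_sq.const_mul 2) (hQL.integrable_sq.const_mul _)]
    refine integral_mono_of_nonneg (Eventually.of_forall fun ω => sq_nonneg _)
      ((hyL.integrable_sq.const_mul 2).add (hQL.integrable_sq.const_mul _))
      (Eventually.of_forall fun ω => ?_)
    simp only [hy]
    nlinarith [sq_nonneg (R t ω + 2 * (β * Q t ω))]
  · have ht0 : 0 < 1 + t := by linarith
    simp only [hn, div_pow]
    rw [integral_div, div_le_div_iff₀ (by positivity) ht0]
    nlinarith [hNsq t ht.le]
  · obtain ⟨G, hG, hbd⟩ := hbd (t + 1) (by linarith)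
    obtain ⟨hQL, hyL, hnL⟩ := hL t ht
    have i1 := hyL.integrable_sq.const_mul a
    have i2 := (integrable_fun_mul_of_memLp_two hnL hyL).const_mul b
    have i3 := hyL.integrable_sq
    have i4 := (integrable_fun_mul_of_memLp_two hyL hQL).const_mul (1 + β)
    have i12 : Integrable (fun ω => a * y t ω ^ 2 + b * (n t ω * y t ω)) P := i1.add i2
    have i34 : Integrable (fun ω => y t ω ^ 2 - (1 + β) * (y t ω * Q t ω)) P := i3.sub i4
    have hexpand : ∀ ω, y t ω * y' t ω = a * y t ω ^ 2 + b * (n t ω * y t ω)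
        + β * (1 / (1 + t)) * (y t ω ^ 2 - (1 + β) * (y t ω * Q t ω)) := fun ω => by
      simp only [hy', hQ']
      ring
    refine (hasDerivAt_integral_sq hym hy'm (hG.const_mul _) (hG.const_mul _)
      (hbd.mono fun ω h s hs => (h s hs).2.1) ⟨ht, by linarith⟩).congr_deriv ?_
    simp only [hexpand]
    rw [integral_add i12 (i34.const_mul _), integral_add i1 i2, integral_const_mul,
      integral_const_mul, integral_const_mul, integral_sub i3 i4, integral_const_mul]
  · obtain ⟨G, hG, hbd⟩ := hbd (t + 1) (by linarith)
    obtain ⟨hQL, hyL, hnL⟩ := hL t ht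
    have i1 := integrable_fun_mul_of_memLp_two hyL hQL
    have i2 := hQL.integrable_sq.const_mul (1 + β)
    have hexpand : ∀ ω, Q t ω * Q' t ω
        = 1 / (1 + t) * (y t ω * Q t ω - (1 + β) * Q t ω ^ 2) := fun ω => by
      simp only [hQ']
      ring
    refine (hasDerivAt_integral_sq hQm hQ'm hG (hG.const_mul _)
      (hbd.mono fun ω h s hs => (h s hs).1) ⟨ht, by linarith⟩).congr_deriv ?_
    simp only [hexpand]
    rw [integral_const_mul, integral_sub i1 i2, integral_const_mul]

end SecondMoments

section Covariance

variable {Ω : Type*} {mΩ : MeasurableSpace Ω} {P : Measure Ω}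

lemma tendsto_integral_mul_zero {f g : ℝ → Ω → ℝ} {K : ℝ} (hf : ∀ t, 0 ≤ t → MemLp (f t) 2 P)
    (hg : ∀ t, 0 ≤ t → MemLp (g t) 2 P) (hK : ∀ᶠ t in atTop, ∫ ω, f t ω ^ 2 ∂P ≤ K)
    (hlim : Tendsto (fun t => ∫ ω, g t ω ^ 2 ∂P) atTop (nhds 0)) :
    Tendsto (fun t => ∫ ω, f t ω * g t ω ∂P) atTop (nhds 0) := by
  rw [Metric.tendsto_nhds]
  intro ε hε
  set l := (|K| + 1) / ε with hl
  have hl0 : 0 < l := by positivity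
  filter_upwards [hK, hlim.eventually_lt_const (div_pos hε hl0), eventually_ge_atTop 0]
    with t hKt hgt ht
  have h1 := two_mul_abs_integral_mul_le (hf t ht) (hg t ht) hl0
  have h2 : l * ∫ ω, g t ω ^ 2 ∂P < ε := by
    rwa [lt_div_iff₀' hl0] at hgt
  have h3 : l⁻¹ * ∫ ω, f t ω ^ 2 ∂P ≤ ε := by
    rw [inv_mul_le_iff₀ hl0, hl, div_mul_cancel₀ _ hε.ne']
    linarith [le_abs_self K]
  rw [Real.dist_eq, sub_zero]
  linarith

lemma tendsto_rcov_add [IsProbabilityMeasure P] {X U R : ℝ → Ω → ℝ} {K L Δ : ℝ} (hΔ : 0 ≤ Δ)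
    (hU : ∀ t, 0 ≤ t → MemLp (U t) 2 P) (hR : ∀ t, 0 ≤ t → MemLp (R t) 2 P)
    (hU0 : ∀ t, 0 ≤ t → ∫ ω, U t ω ∂P = 0) (hK : ∀ t, 0 ≤ t → ∫ ω, U t ω ^ 2 ∂P ≤ K)
    (hUU : Tendsto (fun t => ∫ ω, U t ω * U (t + Δ) ω ∂P) atTop (nhds L))
    (hRlim : Tendsto (fun t => ∫ ω, R t ω ^ 2 ∂P) atTop (nhds 0))
    (hX : ∀ t, 0 ≤ t → X t =ᵐ[P] fun ω => U t ω + R t ω) :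
    Tendsto (fun t => rcov P (X t) (X (t + Δ))) atTop (nhds L) := by
  have hshift : Tendsto (fun t : ℝ => t + Δ) atTop atTop :=
    tendsto_atTop_add_const_right _ _ tendsto_id
  have hpos : ∀ t, 0 ≤ t → 0 ≤ t + Δ := fun t ht => by linarith
  have hRlim' : Tendsto (fun t => ∫ ω, R (t + Δ) ω ^ 2 ∂P) atTop (nhds 0) := hRlim.comp hshift
  have hmean : Tendsto (fun t => ∫ ω, R t ω ∂P) atTop (nhds 0) := by
    simpa using tendsto_integral_mul_zero (f := fun _ _ => 1) (K := 1) (P := P)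
      (fun _ _ => memLp_const 1) hR (by simp) hRlim
  have hUR := tendsto_integral_mul_zero hU (fun t ht => hR _ (hpos t ht))
    (eventually_atTop.2 ⟨0, hK⟩) hRlim'
  have hRU := tendsto_integral_mul_zero (fun t ht => hU _ (hpos t ht)) hR
    (eventually_atTop.2 ⟨0, fun t ht => hK _ (hpos t ht)⟩) hRlim
  have hRR := tendsto_integral_mul_zero hR (fun t ht => hR _ (hpos t ht))
    (hRlim.eventually_le_const one_pos) hRlim'
  have hsum := (((hUU.add hUR).add hRU).add hRR).sub (hmean.mul (hmean.comp hshift))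
  simp only [add_zero, mul_zero, sub_zero] at hsum
  refine hsum.congr' ?_
  filter_upwards [eventually_ge_atTop 0] with t ht
  have hE : ∀ s, 0 ≤ s → ∫ ω, X s ω ∂P = ∫ ω, R s ω ∂P := fun s hs => by
    rw [integral_congr_ae (hX s hs), integral_add ((hU s hs).integrable one_le_two)
      ((hR s hs).integrable one_le_two), hU0 s hs, zero_add]
  have hs := hpos t ht
  have i1 := integrable_fun_mul_of_memLp_two (hU t ht) (hU _ hs)
  have i2 := integrable_fun_mul_of_memLp_two (hU t ht) (hR _ hs)
  have i3 := integrable_fun_mul_of_memLp_two (hU _ hs) (hR t ht)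
  have i4 := integrable_fun_mul_of_memLp_two (hR t ht) (hR _ hs)
  have i12 : Integrable (fun ω => U t ω * U (t + Δ) ω + U t ω * R (t + Δ) ω) P := i1.add i2
  have i123 : Integrable (fun ω => U t ω * U (t + Δ) ω + U t ω * R (t + Δ) ω
    + U (t + Δ) ω * R t ω) P := i12.add i3
  have hprod : ∫ ω, X t ω * X (t + Δ) ω ∂P = (∫ ω, U t ω * U (t + Δ) ω ∂P)
      + (∫ ω, U t ω * R (t + Δ) ω ∂P) + (∫ ω, U (t + Δ) ω * R t ω ∂P)
      + ∫ ω, R t ω * R (t + Δ) ω ∂P := by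
    rw [← integral_add i1 i2, ← integral_add i12 i3, ← integral_add i123 i4]
    refine integral_congr_ae ?_
    filter_upwards [hX t ht, hX _ hs] with ω h1 h2
    simp only [h1, h2]
    ring
  rw [rcov, hE t ht, hE _ hs, hprod]
  rfl

lemma tendsto_rcov_of_continuous [IsProbabilityMeasure P] {B X : ℝ → Ω → ℝ}
    (h : HasBrownianMoments P B) {a b σ c x₀ : ℝ} (ha : a < 0) (hab : a + b < 0)
    (hXm : ∀ t, Measurable (X t)) (hXc : ∀ ω, Continuous fun t => X t ω)
    (heq : ∀ᵐ ω ∂P, ∀ t : ℝ, 0 ≤ t → X t ω = x₀ + (∫ s in (0:ℝ)..t,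
      (a * X s ω + b / (1 + s) * (c + ∫ u in (0:ℝ)..s, X u ω))) + σ * B t ω)
    {Δ : ℝ} (hΔ : 0 ≤ Δ) :
    Tendsto (fun t => rcov P (X t) (X (t + Δ))) atTop
      (nhds (σ ^ 2 / (2 * |a|) * exp (a * Δ))) := by
  set N : ℝ → Ω → ℝ := fun t ω => ouPrimitive a σ (fun s => B s ω) t with hN
  set U : ℝ → Ω → ℝ := fun t ω => a * N t ω + σ * B t ω with hU
  set J : ℝ → Ω → ℝ := fun t ω => residualIntegral a σ c (fun s => B s ω) (fun s => X s ω) t with hJ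
  set R : ℝ → Ω → ℝ := fun t ω =>
    sfdeResidual a b σ c x₀ (fun s => B s ω) (fun s => X s ω) t with hR
  have hNm : ∀ t, Measurable (N t) := h.measurable_ouPrimitive a σ
  have hIm : ∀ t, Measurable fun ω => ∫ s in (0:ℝ)..t, X s ω :=
    measurable_intervalIntegral_of_continuous hXm hXc 0
  have hJm : ∀ t, Measurable (J t) := fun t => ((hIm t).const_add c).sub (hNm t)
  have hRm : ∀ t, Measurable (R t) := fun t =>
    (((hJm t).const_mul a).const_add (x₀ - a * c)).add
      ((measurable_intervalIntegral_of_continuous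
        (fun s => ((hIm s).const_add c).div_const (1 + |s|))
        (fun ω => continuous_integral_div (hXc ω)) 0 t).const_mul b)
  have hdom : ∀ T, 0 < T → ∃ G : Ω → ℝ, MemLp G 2 P ∧ ∀ᵐ ω ∂P, ∀ t ∈ Icc 0 T,
      |N t ω| ≤ G ω ∧ |J t ω| ≤ G ω ∧ |R t ω| ≤ G ω := by
    intro T hT
    have hD : MemLp (fun ω => |σ| * ∫ s in (0:ℝ)..T, |B s ω|) 2 P :=
      (h.memLp_integral_abs hT).const_mul |σ|
    refine ⟨fun ω => |σ| * (∫ s in (0:ℝ)..T, |B s ω|) + exp ((1 + |a| + |b|) * T) *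
        (|c| + |x₀| + |b| * (|σ| * ∫ s in (0:ℝ)..T, |B s ω|)),
      hD.add (((memLp_const (|c| + |x₀|)).add (hD.const_mul |b|)).const_mul _), ?_⟩
    filter_upwards [heq] with ω heq t ht
    have h1 := abs_ouPrimitive_le (σ := σ) ha (h.continuous ω) ht.1 ht.2
    obtain ⟨h2, h3⟩ := residual_bound ha (h.continuous ω) (hXc ω) heq ht.1 ht.2
    have h4 := (abs_nonneg _).trans h1
    have h5 := (abs_nonneg _).trans h2
    exact ⟨by linarith, by linarith, by linarith⟩
  have hRL : ∀ t, 0 ≤ t → MemLp (R t) 2 P := fun t ht => by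
    obtain ⟨G, hG, hbd⟩ := hdom (t + 1) (by linarith)
    exact hG.mono' (hRm t).aestronglyMeasurable
      (hbd.mono fun ω h => (h t ⟨ht, by linarith⟩).2.2)
  have hNL : ∀ t, 0 ≤ t → MemLp (N t) 2 P := fun t ht => h.memLp_ouPrimitive ha σ ht
  have hUL : ∀ t, 0 ≤ t → MemLp (U t) 2 P := fun t ht =>
    ((hNL t ht).const_mul a).add ((h.memLp t ht).const_mul σ)
  have hderiv : ∀ᵐ ω ∂P, ∀ t, 0 ≤ t → HasDerivAt (fun t => J t ω) (R t ω) t ∧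
      HasDerivAt (fun t => R t ω) (a * R t ω + b * ((J t ω + N t ω) / (1 + t))) t := by
    filter_upwards [heq] with ω heq t ht
    exact ⟨hasDerivAt_residualIntegral (h.continuous ω) (hXc ω) heq ht,
      hasDerivAt_residual (h.continuous ω) (hXc ω) heq ht⟩
  have hRlim := tendsto_integral_residual_sq ha hab hNm hJm hRm hdom hderiv
    fun t ht => h.integral_ouPrimitive_sq_le ha σ ht
  have hUU : ∀ δ, 0 ≤ δ → ∀ t, 0 ≤ t → ∫ ω, U t ω * U (t + δ) ω ∂P
      = σ ^ 2 / (2 * |a|) * exp (a * δ) * (1 - exp (a * t) ^ 2) := fun δ hδ t ht => by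
    have ha' : a ≠ 0 := ha.ne
    rw [abs_of_neg ha, ← neg_sub (exp (a * t) ^ 2) 1]
    refine (h.integral_ou_mul_ou ha σ ht hδ).trans ?_
    field_simp
  refine tendsto_rcov_add (K := σ ^ 2 / (2 * |a|)) hΔ hUL hRL (fun t ht => ?_)
    (fun t ht => ?_) ?_ hRlim fun t ht => ?_
  · rw [integral_add (((hNL t ht).integrable one_le_two).const_mul a)
      (((h.memLp t ht).integrable one_le_two).const_mul σ), integral_const_mul, integral_const_mul,
      h.integral_ouPrimitive a σ ht, h.integral_eq_zero t ht]
    simp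
  · have h1 := hUU 0 le_rfl t ht
    simp only [add_zero, mul_zero, exp_zero, mul_one, ← sq] at h1
    rw [h1]
    exact mul_le_of_le_one_right (by positivity) (by linarith [sq_nonneg (exp (a * t))])
  · have h1 : Tendsto (fun t => exp (a * t)) atTop (nhds 0) :=
      tendsto_exp_atBot.comp (tendsto_id.const_mul_atTop_of_neg ha)
    have h2 := ((h1.pow 2).const_sub 1).const_mul (σ ^ 2 / (2 * |a|) * exp (a * Δ))
    simp only [ne_eq, OfNat.ofNat_ne_zero, not_false_eq_true, zero_pow, sub_zero, mul_one] at h2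
    refine h2.congr' ?_
    filter_upwards [eventually_ge_atTop 0] with t ht
    exact (hUU Δ hΔ t ht).symm
  · filter_upwards [heq] with ω heq
    rw [eq_residual_add (hXc ω) heq ht, add_comm]

end Covariance

theorem sfde_limiting_autocovariance {Ω : Type*} {mΩ : MeasurableSpace Ω} (P : Measure Ω) [IsProbabilityMeasure P]
    (F : MeasureTheory.Filtration ℝ mΩ) (a b σ : ℝ) (ψ : ℝ → ℝ) (B X : ℝ → Ω → ℝ)
    (hσ : 0 < σ) (hψ : ContinuousOn ψ (Set.Icc (-1 : ℝ) 0))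
    (hB : IsStdBrownian P F B) (hX : IsSolutionSFDE P F a b σ ψ B X)
    (ha : a < 0) (hab : a + b < 0) :
    ∀ Δ : ℝ, 0 ≤ Δ →
      Filter.Tendsto (fun t : ℝ => rcov P (X t) (X (t + Δ))) Filter.atTop
        (nhds (σ ^ 2 / (2 * |a|) * Real.exp (a * Δ))) := by
  intro Δ hΔ
  obtain ⟨hXF, hXcont, hXeq⟩ := hX
  have hmax : ∀ t : ℝ, 0 ≤ t → max t 0 = t := fun t ht => max_eq_left ht
  have hlim := tendsto_rcov_of_continuous (X := fun t ω => X (max t 0) ω)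
    (σ := σ) (c := ∫ u in (-1:ℝ)..(0:ℝ), ψ u) (x₀ := ψ 0) hB.hasBrownianMoments ha hab
    (fun t => ((hXF _ (le_max_right t 0)).mono (F.le _)).measurable)
    (fun ω => (hXcont ω).comp_continuous (by fun_prop) fun t => le_max_right t 0)
    (hXeq.mono fun ω h t ht => ?_) hΔ
  · refine hlim.congr' ?_
    filter_upwards [eventually_ge_atTop 0] with t ht
    simp only [hmax t ht, hmax (t + Δ) (by linarith)]
  · simp only [hmax t ht]
    rw [h t ht]
    congr 2
    refine intervalIntegral.integral_congr fun s hs => ?_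
    rw [uIcc_of_le ht] at hs
    have hint : ∫ u in (0:ℝ)..s, X (max u 0) ω = ∫ u in (0:ℝ)..s, X u ω := by
      refine intervalIntegral.integral_congr fun u hu => ?_
      rw [uIcc_of_le hs.1] at hu
      simp only [hmax u hu.1]
    simp only [hmax s hs.1, hint]
end
end

section
/- Suppose a = 0 and b < 0. Then lim_{t→∞} E[X(t)] = 0 and lim_{t→∞} Var[X(t)] / t = σ²/3. -/
open MeasureTheory ProbabilityTheory Filter Real Set

noncomputable section

lemma continuousOn_weight (β : ℝ) : ContinuousOn (fun t : ℝ => β / (1 + t)) (Ici 0) := by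
  apply ContinuousOn.div (by fun_prop) (by fun_prop)
  intro x hx
  have : (0 : ℝ) ≤ x := hx
  positivity

lemma intervalIntegrable_weight_mul {f : ℝ → ℝ} {T : ℝ} (hT : 0 ≤ T)
    (hf : IntervalIntegrable f volume 0 T) (β : ℝ) :
    IntervalIntegrable (fun s => β / (1 + s) * f s) volume 0 T :=
  hf.continuousOn_mul ((continuousOn_weight β).mono (by
    rw [uIcc_of_le hT]
    exact Icc_subset_Ici_self))

lemma tendsto_div_of_secondMoment_system {β σ : ℝ} (hβ : 0 < β) {p q r : ℝ → ℝ}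
    (cp : ContinuousOn p (Ici 0)) (cq : ContinuousOn q (Ici 0)) (cr : ContinuousOn r (Ici 0))
    (hp : ∀ t, 0 < t → HasDerivAt p (2 * q t) t)
    (hq : ∀ t, 0 < t → HasDerivAt q (r t - β / (1 + t) * p t) t)
    (hr : ∀ t, 0 < t → HasDerivAt r (-2 * (β / (1 + t)) * q t + σ ^ 2) t) :
    Tendsto (fun t => r t / t) atTop (nhds (σ ^ 2 / 3)) := by
  set κ : ℝ := σ ^ 2 / (3 * β) with hκ
  have hκβ : 3 * β * κ = σ ^ 2 := by rw [hκ]; field_simp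
  set N : ℝ → ℝ := fun t => 2 * (r t - κ - β * κ * (1 + t)) ^ 2
    + 2 * (β / (1 + t) * (p t - κ * (1 + t) ^ 2)) ^ 2
    + 4 * (β / (1 + t)) * (q t - κ * (1 + t)) ^ 2 with hN
  have c1 := continuousOn_weight β
  have hNc : ContinuousOn N (Ici 0) := by fun_prop
  have hNd : ∀ t, 0 < t → HasDerivAt N
      (-(4 * β ^ 2 * (p t - κ * (1 + t) ^ 2) ^ 2 / (1 + t) ^ 3)
        - 4 * β * (q t - κ * (1 + t)) ^ 2 / (1 + t) ^ 2) t := by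
    intro t ht
    have hτ : (1 + t) ≠ 0 := by positivity
    have dτ : HasDerivAt (fun t : ℝ => 1 + t) 1 t := (hasDerivAt_id t).const_add 1
    have dβ := (hasDerivAt_const t β).div dτ hτ
    have d1 := ((((hr t ht).sub_const κ).sub (dτ.const_mul (β * κ))).pow 2).const_mul 2
    have d2 := ((dβ.mul ((hp t ht).sub ((dτ.pow 2).const_mul κ))).pow 2).const_mul 2
    have d3 := (dβ.const_mul 4).mul (((hq t ht).sub (dτ.const_mul κ)).pow 2)
    refine HasDerivAt.congr_deriv (f := N) ((d1.add d2).add d3) ?_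
    simp only [Pi.div_apply, Pi.sub_apply, Pi.mul_apply, Pi.pow_apply]
    rw [← hκβ]
    push_cast
    field_simp
    ring
  have hanti : AntitoneOn N (Ici 0) := by
    apply antitoneOn_of_deriv_nonpos (convex_Ici 0) hNc
    · rw [interior_Ici]
      intro t ht
      exact (hNd t ht).differentiableAt.differentiableWithinAt
    · rw [interior_Ici]
      intro t ht
      have ht' : (0 : ℝ) < t := ht
      rw [(hNd t ht).deriv]
      have h1 : 0 ≤ 4 * β ^ 2 * (p t - κ * (1 + t) ^ 2) ^ 2 / (1 + t) ^ 3 := by positivity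
      have h2 : 0 ≤ 4 * β * (q t - κ * (1 + t)) ^ 2 / (1 + t) ^ 2 := by positivity
      linarith
  have hbd : ∀ t, 0 ≤ t → |r t - κ - β * κ * (1 + t)| ≤ √(N 0) := by
    intro t ht
    apply Real.abs_le_sqrt
    have h := hanti (mem_Ici.2 le_rfl) (mem_Ici.2 ht) ht
    have h1 : 0 ≤ (β / (1 + t) * (p t - κ * (1 + t) ^ 2)) ^ 2 := by positivity
    have h2 : 0 ≤ (β / (1 + t)) * (q t - κ * (1 + t)) ^ 2 := by positivity
    have h3 := sq_nonneg (r t - κ - β * κ * (1 + t))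
    have h4 : N t = 2 * (r t - κ - β * κ * (1 + t)) ^ 2
      + 2 * (β / (1 + t) * (p t - κ * (1 + t) ^ 2)) ^ 2
      + 4 * (β / (1 + t)) * (q t - κ * (1 + t)) ^ 2 := rfl
    linarith
  have hlim : Tendsto (fun t => (r t - κ - β * κ * (1 + t)) / t) atTop (nhds 0) := by
    apply squeeze_zero_norm' (a := fun t => √(N 0) / t)
    · filter_upwards [eventually_gt_atTop 0] with t ht
      rw [norm_div, Real.norm_eq_abs, Real.norm_of_nonneg ht.le]
      gcongr
      exact hbd t ht.le
    · exact tendsto_const_nhds.div_atTop tendsto_id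
  have h2 : Tendsto (fun t : ℝ => (κ + β * κ) / t) atTop (nhds 0) :=
    tendsto_const_nhds.div_atTop tendsto_id
  have h3 := (hlim.add h2).add (tendsto_const_nhds (x := β * κ))
  rw [show (0 + 0 + β * κ) = σ ^ 2 / 3 by linarith] at h3
  refine h3.congr' ?_
  filter_upwards [eventually_gt_atTop 0] with t ht
  field_simp
  ring

lemma tendsto_zero_of_mean_system {β : ℝ} (hβ : 0 < β) {y v : ℝ → ℝ}
    (cy : ContinuousOn y (Ici 0)) (cv : ContinuousOn v (Ici 0))
    (hy : ∀ t, 0 < t → HasDerivAt y (v t) t)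
    (hv : ∀ t, 0 < t → HasDerivAt v (-(β / (1 + t)) * y t) t) :
    Tendsto v atTop (nhds 0) := by
  set E : ℝ → ℝ := fun t => v t ^ 2 + β / (1 + t) * y t ^ 2 with hE
  have c1 := continuousOn_weight β
  have hEc : ContinuousOn E (Ici 0) := by fun_prop
  have hEd : ∀ t, 0 < t → HasDerivAt E (-(β * y t ^ 2 / (1 + t) ^ 2)) t := by
    intro t ht
    have hτ : (1 + t) ≠ 0 := by positivity
    have dτ : HasDerivAt (fun t : ℝ => 1 + t) 1 t := (hasDerivAt_id t).const_add 1
    have dβ := (hasDerivAt_const t β).div dτ hτ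
    refine HasDerivAt.congr_deriv (f := E)
      (((hv t ht).pow 2).add (dβ.mul ((hy t ht).pow 2))) ?_
    simp only [Pi.div_apply]
    push_cast
    field_simp
    ring
  have hanti : AntitoneOn E (Ici 0) := by
    apply antitoneOn_of_deriv_nonpos (convex_Ici 0) hEc
    · rw [interior_Ici]
      intro t ht
      exact (hEd t ht).differentiableAt.differentiableWithinAt
    · rw [interior_Ici]
      intro t ht
      have ht' : (0 : ℝ) < t := ht
      rw [(hEd t ht).deriv]
      have : 0 ≤ β * y t ^ 2 / (1 + t) ^ 2 := by positivity
      linarith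
  set C : ℝ := E 0 / √β with hC
  have hsβ : 0 < √β := Real.sqrt_pos.2 hβ
  have hE0 : 0 ≤ E 0 := by simp only [hE]; positivity
  have hC0 : 0 ≤ C := by positivity
  have hvy : ∀ t, 0 ≤ t → |v t * y t| ≤ C * √(1 + t) := by
    intro t ht
    have h := hanti (mem_Ici.2 le_rfl) (mem_Ici.2 ht) ht
    have hs : 0 < √(1 + t) := Real.sqrt_pos.2 (by positivity)
    have e1 : E t = v t ^ 2 + (√β * y t / √(1 + t)) ^ 2 := by
      simp only [hE]
      rw [div_pow, mul_pow, Real.sq_sqrt hβ.le, Real.sq_sqrt (by positivity)]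
      ring
    have h2 : |v t * (√β * y t / √(1 + t))| ≤ E 0 := by
      rw [abs_le]
      constructor <;>
        nlinarith [sq_nonneg (v t + √β * y t / √(1 + t)), sq_nonneg (v t - √β * y t / √(1 + t)),
          sq_nonneg (v t), sq_nonneg (√β * y t / √(1 + t))]
    have h3 : v t * (√β * y t / √(1 + t)) = (v t * y t) * (√β / √(1 + t)) := by ring
    rw [h3, abs_mul, abs_of_pos (by positivity : 0 < √β / √(1 + t)), mul_div_assoc',
      div_le_iff₀ hs] at h2
    rw [hC, div_mul_eq_mul_div, le_div_iff₀ hsβ]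
    exact h2
  -- The energy is corrected so that its damping no longer oscillates.
  set g : ℝ → ℝ := fun t => √(1 + t) * (E t - v t * y t / (2 * (1 + t))) - C * log (1 + t) with hg
  have hgc : ContinuousOn g (Ici 0) := by
    have c2 : ContinuousOn (fun t => v t * y t / (2 * (1 + t))) (Ici 0) := by
      apply ContinuousOn.div (by fun_prop) (by fun_prop)
      intro x hx
      have : (0 : ℝ) ≤ x := hx
      positivity
    have c3 : ContinuousOn (fun t : ℝ => log (1 + t)) (Ici 0) := by
      apply ContinuousOn.log (by fun_prop)
      intro x hx
      have : (0 : ℝ) ≤ x := hx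
      positivity
    fun_prop
  have hgd : ∀ t, 0 < t → HasDerivAt g
      (v t * y t / (4 * ((1 + t) * √(1 + t))) - C / (1 + t)) t := by
    intro t ht
    have hτ : (1 + t) ≠ 0 := by positivity
    have hs : 0 < √(1 + t) := Real.sqrt_pos.2 (by positivity)
    have hs2 : √(1 + t) ^ 2 = 1 + t := Real.sq_sqrt (by positivity)
    have dτ : HasDerivAt (fun t : ℝ => 1 + t) 1 t := (hasDerivAt_id t).const_add 1
    have d1 := (dτ.sqrt hτ).mul ((hEd t ht).sub
      (((hv t ht).mul (hy t ht)).div (dτ.const_mul 2) (by positivity)))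
    refine HasDerivAt.congr_deriv (f := g) (d1.sub ((dτ.log hτ).const_mul C)) ?_
    simp only [Pi.mul_apply, Pi.sub_apply, Pi.div_apply, hE]
    generalize √(1 + t) = s at hs hs2
    rw [← hs2]
    field_simp
    ring
  have hganti : AntitoneOn g (Ici 0) := by
    apply antitoneOn_of_deriv_nonpos (convex_Ici 0) hgc
    · rw [interior_Ici]
      intro t ht
      exact (hgd t ht).differentiableAt.differentiableWithinAt
    · rw [interior_Ici]
      intro t ht
      have ht' : (0 : ℝ) < t := ht
      rw [(hgd t ht).deriv]
      have hs : 0 < √(1 + t) := Real.sqrt_pos.2 (by positivity)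
      have h1 := le_trans (le_abs_self _) (hvy t ht'.le)
      have h2 : v t * y t / (4 * ((1 + t) * √(1 + t))) ≤ C / (1 + t) := by
        rw [div_le_div_iff₀ (by positivity) (by positivity)]
        have : 0 ≤ C * √(1 + t) := by positivity
        nlinarith
      linarith
  have hEbd : ∀ t, 0 ≤ t → v t ^ 2 ≤ (g 0 + C * log (1 + t) + C) / √(1 + t) := by
    intro t ht
    have hs : 0 < √(1 + t) := Real.sqrt_pos.2 (by positivity)
    have hs2 : √(1 + t) ^ 2 = 1 + t := Real.sq_sqrt (by positivity)
    have h := hganti (mem_Ici.2 le_rfl) (mem_Ici.2 ht) ht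
    have h0 : g t = √(1 + t) * (E t - v t * y t / (2 * (1 + t))) - C * log (1 + t) := rfl
    have h1 := le_trans (le_abs_self _) (hvy t ht)
    have h2 : √(1 + t) * (v t * y t / (2 * (1 + t))) ≤ C := by
      rw [mul_div_assoc', div_le_iff₀ (by positivity)]
      nlinarith
    have h3 : v t ^ 2 ≤ E t := by
      simp only [hE]
      have : 0 ≤ β / (1 + t) * y t ^ 2 := by positivity
      linarith
    rw [le_div_iff₀ hs]
    have := mul_le_mul_of_nonneg_right h3 hs.le
    linarith
  have hlim : Tendsto (fun t : ℝ => (g 0 + C * log (1 + t) + C) / √(1 + t)) atTop (nhds 0) := by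
    have h1 : Tendsto (fun t : ℝ => 1 + t) atTop atTop := tendsto_atTop_add_const_left _ _ tendsto_id
    have h2 : Tendsto (fun x : ℝ => log x / √x) atTop (nhds 0) := by
      simp only [Real.sqrt_eq_rpow]
      exact (isLittleO_log_rpow_atTop (by norm_num)).tendsto_div_nhds_zero
    have h3 : Tendsto (fun x : ℝ => (g 0 + C) / √x) atTop (nhds 0) :=
      tendsto_const_nhds.div_atTop Real.tendsto_sqrt_atTop
    have h4 := ((h2.const_mul C).add h3).comp h1
    rw [mul_zero, zero_add] at h4
    refine h4.congr fun t => ?_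
    simp only [Function.comp]
    ring
  have hsq : Tendsto (fun t => v t ^ 2) atTop (nhds 0) := by
    refine squeeze_zero' (Eventually.of_forall fun t => sq_nonneg _) ?_ hlim
    filter_upwards [eventually_ge_atTop 0] with t ht using hEbd t ht
  rw [tendsto_zero_iff_abs_tendsto_zero]
  have := hsq.sqrt
  simpa [Real.sqrt_sq_eq_abs, Function.comp_def] using this

lemma continuousOn_of_eq_add_integral {p f : ℝ → ℝ} {p₀ : ℝ}
    (hf : ∀ T, 0 ≤ T → IntervalIntegrable f volume 0 T)
    (hp : ∀ T, 0 ≤ T → p T = p₀ + ∫ s in (0 : ℝ)..T, f s) : ContinuousOn p (Ici 0) := by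
  intro x hx
  have hx0 : (0 : ℝ) ≤ x := hx
  have hcont : ContinuousOn (fun T => ∫ s in (0 : ℝ)..T, f s) (Icc 0 (x + 1)) := by
    have := intervalIntegral.continuousOn_primitive_interval' (hf (x + 1) (by positivity))
      (left_mem_uIcc)
    rwa [uIcc_of_le (by positivity)] at this
  have h1 : ContinuousOn p (Icc 0 (x + 1)) :=
    (hcont.const_add p₀).congr fun T hT => hp T hT.1
  refine (h1 x ⟨hx0, by linarith⟩).mono_of_mem_nhdsWithin ?_
  rw [← Ici_inter_Iic]
  exact inter_mem self_mem_nhdsWithin (mem_nhdsWithin_of_mem_nhds (Iic_mem_nhds (by linarith)))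

lemma hasDerivAt_of_eq_add_integral {p f : ℝ → ℝ} {p₀ : ℝ} (hf : ContinuousOn f (Ici 0))
    (hp : ∀ T, 0 ≤ T → p T = p₀ + ∫ s in (0 : ℝ)..T, f s) {t : ℝ} (ht : 0 < t) :
    HasDerivAt p (f t) t := by
  have h1 : HasDerivAt (fun T => ∫ s in (0 : ℝ)..T, f s) (f t) t := by
    apply intervalIntegral.integral_hasDerivAt_right
    · exact (hf.mono (by rw [uIcc_of_le ht.le]; exact Icc_subset_Ici_self)).intervalIntegrable
    · exact (hf.mono Ioi_subset_Ici_self).stronglyMeasurableAtFilter isOpen_Ioi t ht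
    · exact hf.continuousAt (Ici_mem_nhds ht)
  refine (h1.const_add p₀).congr_of_eventuallyEq ?_
  filter_upwards [Ioi_mem_nhds ht] with T hT using hp T (le_of_lt hT)

/-- Expectation of the fundamental theorem of calculus along the paths of a process. -/
lemma integral_eq_add_intervalIntegral_integral {Ω : Type*} {mΩ : MeasurableSpace Ω}
    {P : Measure Ω} [IsProbabilityMeasure P] {G H : ℝ → Ω → ℝ} {T : ℝ} (hT : 0 ≤ T)
    (hG : ∀ᵐ ω ∂P, ContinuousOn (fun t => G t ω) (Icc 0 T) ∧
      ∀ t ∈ Ioo 0 T, HasDerivAt (fun t => G t ω) (H t ω) t)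
    (hH : Integrable (Function.uncurry H) ((volume.restrict (Ioc 0 T)).prod P))
    (hG₀ : Integrable (G 0) P) :
    ∫ ω, G T ω ∂P = ∫ ω, G 0 ω ∂P + ∫ s in (0 : ℝ)..T, ∫ ω, H s ω ∂P := by
  have h1 : G T =ᵐ[P] fun ω => G 0 ω + ∫ s in Ioc 0 T, H s ω := by
    filter_upwards [hG, hH.prod_left_ae] with ω hω hint
    have h := intervalIntegral.integral_eq_sub_of_hasDerivAt_of_le hT hω.1 hω.2
      ((intervalIntegrable_iff_integrableOn_Ioc_of_le hT).2 hint)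
    rw [intervalIntegral.integral_of_le hT] at h
    linarith
  have h2 : Integrable (fun ω => ∫ s in Ioc 0 T, H s ω) P := hH.integral_prod_right
  rw [integral_congr_ae h1, integral_add hG₀ h2,
    intervalIntegral.integral_of_le hT, integral_integral_swap hH]

/-- A process which is square integrable at every nonnegative time, and jointly square integrable
in time and chance on bounded time intervals. -/
def IsLocallySquareIntegrable {Ω : Type*} {mΩ : MeasurableSpace Ω} (P : Measure Ω)
    (Z : ℝ → Ω → ℝ) : Prop :=
  ∀ T, 0 ≤ T → MemLp (Z T) 2 P ∧
    MemLp (Function.uncurry Z) 2 ((volume.restrict (Ioc 0 T)).prod P)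

namespace IsLocallySquareIntegrable

variable {Ω : Type*} {mΩ : MeasurableSpace Ω} {P : Measure Ω} {Z Z' : ℝ → Ω → ℝ}

lemma integrable_mul (h : IsLocallySquareIntegrable P Z) (h' : IsLocallySquareIntegrable P Z')
    {t : ℝ} (ht : 0 ≤ t) : Integrable (fun ω => Z t ω * Z' t ω) P :=
  (h t ht).1.integrable_mul (h' t ht).1

lemma integrable_uncurry_mul (h : IsLocallySquareIntegrable P Z)
    (h' : IsLocallySquareIntegrable P Z') {T : ℝ} (hT : 0 ≤ T) :
    Integrable (Function.uncurry fun t ω => Z t ω * Z' t ω)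
      ((volume.restrict (Ioc 0 T)).prod P) :=
  (h T hT).2.integrable_mul (h' T hT).2

lemma const [IsProbabilityMeasure P] {ξ : Ω → ℝ} (h : MemLp ξ 2 P) :
    IsLocallySquareIntegrable P fun _ => ξ :=
  fun _ _ => ⟨h, h.comp_snd _⟩

lemma add (h : IsLocallySquareIntegrable P Z) (h' : IsLocallySquareIntegrable P Z') :
    IsLocallySquareIntegrable P fun t ω => Z t ω + Z' t ω :=
  fun T hT => ⟨(h T hT).1.add (h' T hT).1, (h T hT).2.add (h' T hT).2⟩

lemma const_mul (h : IsLocallySquareIntegrable P Z) (σ : ℝ) :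
    IsLocallySquareIntegrable P fun t ω => σ * Z t ω :=
  fun T hT => ⟨(h T hT).1.const_mul σ, (h T hT).2.const_mul σ⟩

lemma weight_mul (h : IsLocallySquareIntegrable P Z) (β : ℝ) :
    IsLocallySquareIntegrable P fun t ω => β / (1 + t) * Z t ω := by
  refine fun T hT => ⟨(h T hT).1.const_mul _, ?_⟩
  refine (h T hT).2.of_le_mul (c := |β|) ?_ ?_
  · have hw : Measurable fun x : ℝ × Ω => β / (1 + x.1) := by fun_prop
    exact hw.aestronglyMeasurable.mul (h T hT).2.1
  · have h1 : ∀ᵐ x ∂((volume.restrict (Ioc 0 T)).prod P), x.1 ∈ Ioc 0 T :=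
      Measure.quasiMeasurePreserving_fst.ae (ae_restrict_mem measurableSet_Ioc)
    filter_upwards [h1] with x hx
    have hx1 : (0 : ℝ) < x.1 := hx.1
    rw [Function.uncurry, norm_mul, norm_div, Real.norm_eq_abs, Real.norm_eq_abs (1 + x.1),
      abs_of_pos (by positivity : 0 < 1 + x.1)]
    refine mul_le_mul_of_nonneg_right (div_le_self (abs_nonneg _) (by linarith)) (norm_nonneg _)

lemma intervalIntegrable_integral_mul [IsProbabilityMeasure P] (h : IsLocallySquareIntegrable P Z)
    (h' : IsLocallySquareIntegrable P Z') {T : ℝ} (hT : 0 ≤ T) :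
    IntervalIntegrable (fun t => ∫ ω, Z t ω * Z' t ω ∂P) volume 0 T :=
  (intervalIntegrable_iff_integrableOn_Ioc_of_le hT).2
    (h.integrable_uncurry_mul h' hT).integral_prod_left

end IsLocallySquareIntegrable

/-- The pathwise system `Y' = V + σ B`, `V' = -β / (1 + t) Y` driven by a process `B` with the
first and second moments of a Brownian motion, whose increments are uncorrelated with the past
of `V + σ B`. -/
structure IsDrivenOscillator {Ω : Type*} {mΩ : MeasurableSpace Ω} (P : Measure Ω)
    (β σ c v : ℝ) (Y V B : ℝ → Ω → ℝ) : Prop where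
  meas_Y : ∀ t, Measurable (Y t)
  meas_V : ∀ t, Measurable (V t)
  meas_B : ∀ t, Measurable (B t)
  cont_Y : ∀ ω, Continuous fun t => Y t ω
  cont_V : ∀ ω, Continuous fun t => V t ω
  cont_B : ∀ ω, Continuous fun t => B t ω
  ae_path : ∀ᵐ ω ∂P, Y 0 ω = c ∧ V 0 ω = v ∧ ∀ t, 0 < t →
    HasDerivAt (fun t => Y t ω) (V t ω + σ * B t ω) t ∧
    HasDerivAt (fun t => V t ω) (-(β / (1 + t) * Y t ω)) t
  memLp_B : ∀ t, 0 ≤ t → MemLp (B t) 2 P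
  mean_B : ∀ t, 0 ≤ t → ∫ ω, B t ω ∂P = 0
  sq_B : ∀ t, 0 ≤ t → ∫ ω, B t ω * B t ω ∂P = t
  orth : ∀ u s t, 0 ≤ u → u ≤ s → s ≤ t →
    ∫ ω, (V u ω + σ * B u ω) * (B t ω - B s ω) ∂P = 0

namespace IsDrivenOscillator

variable {Ω : Type*} {mΩ : MeasurableSpace Ω} {P : Measure Ω} [IsProbabilityMeasure P]
  {β σ c v : ℝ} {Y V B : ℝ → Ω → ℝ}

lemma isLocallySquareIntegrable_B (h : IsDrivenOscillator P β σ c v Y V B) :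
    IsLocallySquareIntegrable P B := by
  refine fun T hT => ⟨h.memLp_B T hT, ?_⟩
  have hm := measurable_uncurry_of_continuous_of_measurable h.cont_B h.meas_B
  rw [memLp_two_iff_integrable_sq hm.aestronglyMeasurable,
    integrable_prod_iff (hm.pow_const 2).aestronglyMeasurable]
  constructor
  · filter_upwards [ae_restrict_mem measurableSet_Ioc] with t ht
    exact (h.memLp_B t ht.1.le).integrable_sq
  · have h1 : IntegrableOn (fun t : ℝ => t) (Ioc 0 T) :=
      (continuous_id.integrableOn_Icc).mono_set Ioc_subset_Icc_self
    refine h1.congr ?_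
    filter_upwards [ae_restrict_mem measurableSet_Ioc] with t ht
    refine (h.sq_B t ht.1.le).symm.trans (integral_congr_ae (Eventually.of_forall fun ω => ?_))
    simp [Function.uncurry, sq]

lemma exists_integrable_bound (hβ : 0 < β) (h : IsDrivenOscillator P β σ c v Y V B) {T : ℝ}
    (hT : 0 ≤ T) : ∃ D : Ω → ℝ, Integrable D P ∧
      ∀ᵐ ω ∂P, ∀ t ∈ Icc 0 T, Y t ω ^ 2 + V t ω ^ 2 ≤ D ω := by
  refine ⟨fun ω => exp ((β + 2) * T) * (c ^ 2 + v ^ 2 + σ ^ 2 * ∫ s in Ioc 0 T, B s ω ^ 2), ?_, ?_⟩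
  · have h1 := (h.isLocallySquareIntegrable_B T hT).2.integrable_sq.integral_prod_right
    exact ((integrable_const _).add (h1.const_mul _)).const_mul _
  · filter_upwards [h.ae_path] with ω ⟨hY0, hV0, hd⟩ t ht
    have hB2 : Continuous fun s => B s ω ^ 2 := (h.cont_B ω).pow 2
    have hcY := h.cont_Y ω
    have hcV := h.cont_V ω
    set G : ℝ → ℝ := fun t => exp (-((β + 2) * t)) * (Y t ω ^ 2 + V t ω ^ 2)
      - σ ^ 2 * ∫ s in (0 : ℝ)..t, B s ω ^ 2 with hG
    have hprim : ∀ t, HasDerivAt (fun t => ∫ s in (0 : ℝ)..t, B s ω ^ 2) (B t ω ^ 2) t :=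
      fun t => intervalIntegral.integral_hasDerivAt_right (hB2.intervalIntegrable _ _)
        hB2.aestronglyMeasurable.stronglyMeasurableAtFilter hB2.continuousAt
    have hGc : Continuous G := by
      have : Continuous fun t => ∫ s in (0 : ℝ)..t, B s ω ^ 2 :=
        continuous_iff_continuousAt.2 fun t => (hprim t).continuousAt
      fun_prop
    have hGd : ∀ t, 0 < t → HasDerivAt G
        (exp (-((β + 2) * t)) * (2 * Y t ω * (V t ω + σ * B t ω)
          - 2 * V t ω * (β / (1 + t) * Y t ω) - (β + 2) * (Y t ω ^ 2 + V t ω ^ 2))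
          - σ ^ 2 * B t ω ^ 2) t := by
      intro t ht
      obtain ⟨dY, dV⟩ := hd t ht
      have de := (((hasDerivAt_id t).const_mul (β + 2)).neg).exp
      refine HasDerivAt.congr_deriv (f := G)
        ((de.mul ((dY.pow 2).add (dV.pow 2))).sub ((hprim t).const_mul (σ ^ 2))) ?_
      simp only [Pi.add_apply, Pi.pow_apply, Pi.neg_apply, id]
      push_cast
      ring
    have hanti : AntitoneOn G (Ici 0) := by
      apply antitoneOn_of_deriv_nonpos (convex_Ici 0) hGc.continuousOn
      · rw [interior_Ici]
        intro t ht
        exact (hGd t ht).differentiableAt.differentiableWithinAt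
      · rw [interior_Ici]
        intro t ht
        have ht' : (0 : ℝ) < t := ht
        rw [(hGd t ht).deriv]
        have hw0 : 0 ≤ β / (1 + t) := by positivity
        have hwβ : β / (1 + t) ≤ β := div_le_self hβ.le (by linarith)
        have he1 : exp (-((β + 2) * t)) ≤ 1 := exp_le_one_iff.2 (by
          have : 0 ≤ (β + 2) * t := by positivity
          linarith)
        have he0 := exp_pos (-((β + 2) * t))
        generalize β / (1 + t) = w at hw0 hwβ
        have h1 : 2 * Y t ω * (V t ω + σ * B t ω) - 2 * V t ω * (w * Y t ω)
            - (β + 2) * (Y t ω ^ 2 + V t ω ^ 2) ≤ σ ^ 2 * B t ω ^ 2 := by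
          nlinarith [sq_nonneg (Y t ω - V t ω), sq_nonneg (Y t ω - σ * B t ω),
            mul_nonneg hw0 (sq_nonneg (Y t ω + V t ω)), sq_nonneg (V t ω),
            mul_nonneg (sub_nonneg.2 hwβ) (add_nonneg (sq_nonneg (Y t ω)) (sq_nonneg (V t ω)))]
        have h2 : 0 ≤ σ ^ 2 * B t ω ^ 2 := by positivity
        nlinarith
    have h1 := hanti (mem_Ici.2 le_rfl) (mem_Ici.2 ht.1) ht.1
    have hG0 : G 0 = c ^ 2 + v ^ 2 := by simp [hG, hY0, hV0]
    have hGt : G t = exp (-((β + 2) * t)) * (Y t ω ^ 2 + V t ω ^ 2)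
      - σ ^ 2 * ∫ s in (0 : ℝ)..t, B s ω ^ 2 := rfl
    have hmono : ∫ s in (0 : ℝ)..t, B s ω ^ 2 ≤ ∫ s in Ioc 0 T, B s ω ^ 2 := by
      rw [← intervalIntegral.integral_of_le hT]
      exact intervalIntegral.integral_mono_interval le_rfl ht.1 ht.2
        (Eventually.of_forall fun s => sq_nonneg _) (hB2.intervalIntegrable _ _)
    have hσ := mul_le_mul_of_nonneg_left hmono (sq_nonneg σ)
    have h3 : exp (-((β + 2) * t)) * (Y t ω ^ 2 + V t ω ^ 2)
        ≤ c ^ 2 + v ^ 2 + σ ^ 2 * ∫ s in Ioc 0 T, B s ω ^ 2 := by linarith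
    have h4 : Y t ω ^ 2 + V t ω ^ 2
        ≤ exp ((β + 2) * t) * (c ^ 2 + v ^ 2 + σ ^ 2 * ∫ s in Ioc 0 T, B s ω ^ 2) := by
      rwa [exp_neg, inv_mul_le_iff₀ (exp_pos _)] at h3
    have hnn : 0 ≤ c ^ 2 + v ^ 2 + σ ^ 2 * ∫ s in Ioc 0 T, B s ω ^ 2 :=
      le_trans (by positivity) h3
    refine h4.trans (mul_le_mul_of_nonneg_right (exp_le_exp.2 ?_) hnn)
    exact mul_le_mul_of_nonneg_left ht.2 (by positivity)

lemma isLocallySquareIntegrable_of_bound {Z : ℝ → Ω → ℝ} (hZ : ∀ t, Measurable (Z t))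
    (cZ : ∀ ω, Continuous fun t => Z t ω)
    (h : ∀ T : ℝ, 0 ≤ T → ∃ D : Ω → ℝ, Integrable D P ∧ ∀ᵐ ω ∂P, ∀ t ∈ Icc 0 T, Z t ω ^ 2 ≤ D ω) :
    IsLocallySquareIntegrable P Z := by
  intro T hT
  obtain ⟨D, hD, hZD⟩ := h T hT
  have hm := measurable_uncurry_of_continuous_of_measurable cZ hZ
  rw [memLp_two_iff_integrable_sq (hZ T).aestronglyMeasurable,
    memLp_two_iff_integrable_sq hm.aestronglyMeasurable]
  constructor
  · refine hD.mono' ((hZ T).pow_const 2).aestronglyMeasurable ?_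
    filter_upwards [hZD] with ω hω
    rw [Real.norm_of_nonneg (sq_nonneg _)]
    exact hω T ⟨hT, le_rfl⟩
  · refine (hD.comp_snd (volume.restrict (Ioc 0 T))).mono' (hm.pow_const 2).aestronglyMeasurable ?_
    have h1 : ∀ᵐ x ∂((volume.restrict (Ioc 0 T)).prod P), x.1 ∈ Ioc 0 T :=
      Measure.quasiMeasurePreserving_fst.ae (ae_restrict_mem measurableSet_Ioc)
    have h2 : ∀ᵐ x ∂((volume.restrict (Ioc 0 T)).prod P), ∀ t ∈ Icc 0 T, Z t x.2 ^ 2 ≤ D x.2 :=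
      Measure.quasiMeasurePreserving_snd.ae hZD
    filter_upwards [h1, h2] with x hx1 hx2
    rw [Real.norm_of_nonneg (sq_nonneg _)]
    exact hx2 x.1 ⟨hx1.1.le, hx1.2⟩

lemma isLocallySquareIntegrable_Y (hβ : 0 < β) (h : IsDrivenOscillator P β σ c v Y V B) :
    IsLocallySquareIntegrable P Y := by
  refine isLocallySquareIntegrable_of_bound h.meas_Y h.cont_Y fun T hT => ?_
  obtain ⟨D, hD, hb⟩ := h.exists_integrable_bound hβ hT
  refine ⟨D, hD, ?_⟩
  filter_upwards [hb] with ω hω t ht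
  linarith [hω t ht, sq_nonneg (V t ω)]

lemma isLocallySquareIntegrable_V (hβ : 0 < β) (h : IsDrivenOscillator P β σ c v Y V B) :
    IsLocallySquareIntegrable P V := by
  refine isLocallySquareIntegrable_of_bound h.meas_V h.cont_V fun T hT => ?_
  obtain ⟨D, hD, hb⟩ := h.exists_integrable_bound hβ hT
  refine ⟨D, hD, ?_⟩
  filter_upwards [hb] with ω hω t ht
  linarith [hω t ht, sq_nonneg (Y t ω)]

lemma integral_Y_mul (hβ : 0 < β) (h : IsDrivenOscillator P β σ c v Y V B) {ξ : Ω → ℝ}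
    (hξ : MemLp ξ 2 P) {T : ℝ} (hT : 0 ≤ T) :
    ∫ ω, Y T ω * ξ ω ∂P = c * ∫ ω, ξ ω ∂P
      + ∫ s in (0 : ℝ)..T, ∫ ω, (V s ω + σ * B s ω) * ξ ω ∂P := by
  have hX := (h.isLocallySquareIntegrable_V hβ).add (h.isLocallySquareIntegrable_B.const_mul σ)
  have h0 : (fun ω => Y 0 ω * ξ ω) =ᵐ[P] fun ω => c * ξ ω := by
    filter_upwards [h.ae_path] with ω hω
    rw [hω.1]
  rw [integral_eq_add_intervalIntegral_integral (G := fun t ω => Y t ω * ξ ω)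
    (H := fun s ω => (V s ω + σ * B s ω) * ξ ω) hT ?_
    (hX.integrable_uncurry_mul (IsLocallySquareIntegrable.const hξ) hT)
    (((hξ.integrable one_le_two).const_mul c).congr h0.symm),
    integral_congr_ae h0, integral_const_mul]
  filter_upwards [h.ae_path] with ω hω
  refine ⟨((h.cont_Y ω).mul continuous_const).continuousOn, fun t ht => ?_⟩
  exact (hω.2.2 t ht.1).1.mul_const _

lemma integral_V_mul (hβ : 0 < β) (h : IsDrivenOscillator P β σ c v Y V B) {ξ : Ω → ℝ}
    (hξ : MemLp ξ 2 P) {T : ℝ} (hT : 0 ≤ T) :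
    ∫ ω, V T ω * ξ ω ∂P = v * ∫ ω, ξ ω ∂P
      + ∫ s in (0 : ℝ)..T, -(β / (1 + s)) * ∫ ω, Y s ω * ξ ω ∂P := by
  have hW := (h.isLocallySquareIntegrable_Y hβ).weight_mul β
  have h0 : (fun ω => V 0 ω * ξ ω) =ᵐ[P] fun ω => v * ξ ω := by
    filter_upwards [h.ae_path] with ω hω
    rw [hω.2.1]
  rw [integral_eq_add_intervalIntegral_integral (G := fun t ω => V t ω * ξ ω)
    (H := fun s ω => -(β / (1 + s) * Y s ω * ξ ω)) hT ?_
    (hW.integrable_uncurry_mul (IsLocallySquareIntegrable.const hξ) hT).neg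
    (((hξ.integrable one_le_two).const_mul v).congr h0.symm),
    integral_congr_ae h0, integral_const_mul]
  · simp only [← integral_const_mul, neg_mul, mul_assoc, integral_neg]
  filter_upwards [h.ae_path] with ω hω
  refine ⟨((h.cont_V ω).mul continuous_const).continuousOn, fun t ht => ?_⟩
  exact ((hω.2.2 t ht.1).2.mul_const _).congr_deriv (by ring)

lemma integral_Y_mul_Y (hβ : 0 < β) (h : IsDrivenOscillator P β σ c v Y V B) {T : ℝ}
    (hT : 0 ≤ T) :
    ∫ ω, Y T ω * Y T ω ∂P = ∫ ω, Y 0 ω * Y 0 ω ∂P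
      + ∫ s in (0 : ℝ)..T, 2 * (∫ ω, Y s ω * V s ω ∂P + σ * ∫ ω, Y s ω * B s ω ∂P) := by
  have hY := h.isLocallySquareIntegrable_Y hβ
  have hV := h.isLocallySquareIntegrable_V hβ
  have hB := h.isLocallySquareIntegrable_B
  rw [integral_eq_add_intervalIntegral_integral (G := fun t ω => Y t ω * Y t ω)
    (H := fun s ω => 2 * (Y s ω * V s ω + σ * (Y s ω * B s ω))) hT ?_
    (((hY.integrable_uncurry_mul hV hT).add
      ((hY.integrable_uncurry_mul hB hT).const_mul σ)).const_mul 2)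
    (hY.integrable_mul hY le_rfl)]
  · congr 1
    refine intervalIntegral.integral_congr fun s hs => ?_
    rw [uIcc_of_le hT] at hs
    rw [integral_const_mul, integral_add (hY.integrable_mul hV hs.1)
      ((hY.integrable_mul hB hs.1).const_mul σ), integral_const_mul]
  filter_upwards [h.ae_path] with ω hω
  refine ⟨((h.cont_Y ω).mul (h.cont_Y ω)).continuousOn, fun t ht => ?_⟩
  exact ((hω.2.2 t ht.1).1.mul (hω.2.2 t ht.1).1).congr_deriv (by ring)

lemma integral_Y_mul_V (hβ : 0 < β) (h : IsDrivenOscillator P β σ c v Y V B) {T : ℝ}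
    (hT : 0 ≤ T) :
    ∫ ω, Y T ω * V T ω ∂P = ∫ ω, Y 0 ω * V 0 ω ∂P
      + ∫ s in (0 : ℝ)..T, (∫ ω, V s ω * V s ω ∂P + σ * ∫ ω, V s ω * B s ω ∂P
        - β / (1 + s) * ∫ ω, Y s ω * Y s ω ∂P) := by
  have hY := h.isLocallySquareIntegrable_Y hβ
  have hV := h.isLocallySquareIntegrable_V hβ
  have hB := h.isLocallySquareIntegrable_B
  have hW := hY.weight_mul β
  rw [integral_eq_add_intervalIntegral_integral (G := fun t ω => Y t ω * V t ω)
    (H := fun s ω => V s ω * V s ω + σ * (V s ω * B s ω) - β / (1 + s) * Y s ω * Y s ω) hT ?_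
    (((hV.integrable_uncurry_mul hV hT).add
      ((hV.integrable_uncurry_mul hB hT).const_mul σ)).sub (hW.integrable_uncurry_mul hY hT))
    (hY.integrable_mul hV le_rfl)]
  · congr 1
    refine intervalIntegral.integral_congr fun s hs => ?_
    rw [uIcc_of_le hT] at hs
    have i1 := hV.integrable_mul hV hs.1
    have i2 := (hV.integrable_mul hB hs.1).const_mul σ
    have i12 : Integrable (fun ω => V s ω * V s ω + σ * (V s ω * B s ω)) P := i1.add i2
    rw [integral_sub i12 (hW.integrable_mul hY hs.1), integral_add i1 i2,
      integral_const_mul, ← integral_const_mul (β / (1 + s))]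
    simp only [mul_assoc]
  filter_upwards [h.ae_path] with ω hω
  refine ⟨((h.cont_Y ω).mul (h.cont_V ω)).continuousOn, fun t ht => ?_⟩
  exact ((hω.2.2 t ht.1).1.mul (hω.2.2 t ht.1).2).congr_deriv (by ring)

lemma integral_V_mul_V (hβ : 0 < β) (h : IsDrivenOscillator P β σ c v Y V B) {T : ℝ}
    (hT : 0 ≤ T) :
    ∫ ω, V T ω * V T ω ∂P = ∫ ω, V 0 ω * V 0 ω ∂P
      + ∫ s in (0 : ℝ)..T, -2 * (β / (1 + s)) * ∫ ω, Y s ω * V s ω ∂P := by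
  have hY := h.isLocallySquareIntegrable_Y hβ
  have hV := h.isLocallySquareIntegrable_V hβ
  have hW := hY.weight_mul β
  rw [integral_eq_add_intervalIntegral_integral (G := fun t ω => V t ω * V t ω)
    (H := fun s ω => -2 * (β / (1 + s) * Y s ω * V s ω)) hT ?_
    ((hW.integrable_uncurry_mul hV hT).const_mul (-2)) (hV.integrable_mul hV le_rfl)]
  · simp only [← integral_const_mul, mul_assoc]
  filter_upwards [h.ae_path] with ω hω
  refine ⟨((h.cont_V ω).mul (h.cont_V ω)).continuousOn, fun t ht => ?_⟩
  exact ((hω.2.2 t ht.1).2.mul (hω.2.2 t ht.1).2).congr_deriv (by ring)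

lemma integral_V_add_mul_B (hβ : 0 < β) (h : IsDrivenOscillator P β σ c v Y V B) {s t : ℝ}
    (hs : 0 ≤ s) (hst : s ≤ t) :
    ∫ ω, (V s ω + σ * B s ω) * B t ω ∂P = ∫ ω, V s ω * B s ω ∂P + σ * s := by
  have hV := h.isLocallySquareIntegrable_V hβ
  have hB := h.isLocallySquareIntegrable_B
  have hX := hV.add (hB.const_mul σ)
  have h1 := h.orth s s t hs le_rfl hst
  simp only [mul_sub] at h1
  have i1 : Integrable (fun ω => (V s ω + σ * B s ω) * B t ω) P :=
    (hX s hs).1.integrable_mul (hB t (hs.trans hst)).1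
  rw [integral_sub i1 (hX.integrable_mul hB hs), sub_eq_zero] at h1
  rw [h1]
  simp only [add_mul, mul_assoc]
  rw [integral_add (hV.integrable_mul hB hs) ((hB.integrable_mul hB hs).const_mul σ),
    integral_const_mul, h.sq_B s hs]

lemma integral_Y_mul_B_of_le (hβ : 0 < β) (h : IsDrivenOscillator P β σ c v Y V B) {s t : ℝ}
    (hs : 0 ≤ s) (hst : s ≤ t) :
    ∫ ω, Y s ω * B t ω ∂P = ∫ ω, Y s ω * B s ω ∂P := by
  have ht := hs.trans hst
  have hY := h.isLocallySquareIntegrable_Y hβ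
  have h1 := h.integral_Y_mul hβ (h.memLp_B t ht) hs
  have h2 := h.integral_Y_mul hβ (h.memLp_B s hs) hs
  rw [h1, h2, h.mean_B t ht, h.mean_B s hs]
  congr 1
  refine intervalIntegral.integral_congr fun u hu => ?_
  rw [uIcc_of_le hs] at hu
  rw [h.integral_V_add_mul_B hβ hu.1 (hu.2.trans hst), h.integral_V_add_mul_B hβ hu.1 hu.2]

lemma integral_Y_mul_B (hβ : 0 < β) (h : IsDrivenOscillator P β σ c v Y V B) {T : ℝ}
    (hT : 0 ≤ T) :
    ∫ ω, Y T ω * B T ω ∂P = 0 + ∫ s in (0 : ℝ)..T, (∫ ω, V s ω * B s ω ∂P + σ * s) := by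
  rw [h.integral_Y_mul hβ (h.memLp_B T hT) hT, h.mean_B T hT, mul_zero]
  congr 1
  refine intervalIntegral.integral_congr fun u hu => ?_
  rw [uIcc_of_le hT] at hu
  exact h.integral_V_add_mul_B hβ hu.1 hu.2

lemma integral_V_mul_B (hβ : 0 < β) (h : IsDrivenOscillator P β σ c v Y V B) {T : ℝ}
    (hT : 0 ≤ T) :
    ∫ ω, V T ω * B T ω ∂P = 0 + ∫ s in (0 : ℝ)..T, -(β / (1 + s)) * ∫ ω, Y s ω * B s ω ∂P := by
  rw [h.integral_V_mul hβ (h.memLp_B T hT) hT, h.mean_B T hT, mul_zero]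
  congr 1
  refine intervalIntegral.integral_congr fun u hu => ?_
  rw [uIcc_of_le hT] at hu
  rw [h.integral_Y_mul_B_of_le hβ hu.1 hu.2]

lemma tendsto_secondMoment_div (hβ : 0 < β) (h : IsDrivenOscillator P β σ c v Y V B) :
    Tendsto (fun t => (∫ ω, (V t ω + σ * B t ω) ^ 2 ∂P) / t) atTop (nhds (σ ^ 2 / 3)) := by
  have hY := h.isLocallySquareIntegrable_Y hβ
  have hV := h.isLocallySquareIntegrable_V hβ
  have hB := h.isLocallySquareIntegrable_B
  have cw := continuousOn_weight β
  have iYY := fun T hT => hY.intervalIntegrable_integral_mul hY (T := T) hT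
  have iYV := fun T hT => hY.intervalIntegrable_integral_mul hV (T := T) hT
  have iYB := fun T hT => hY.intervalIntegrable_integral_mul hB (T := T) hT
  have iVV := fun T hT => hV.intervalIntegrable_integral_mul hV (T := T) hT
  have iVB := fun T hT => hV.intervalIntegrable_integral_mul hB (T := T) hT
  have eYY := fun T hT => h.integral_Y_mul_Y hβ (T := T) hT
  have eYV := fun T hT => h.integral_Y_mul_V hβ (T := T) hT
  have eYB := fun T hT => h.integral_Y_mul_B hβ (T := T) hT
  have eVV := fun T hT => h.integral_V_mul_V hβ (T := T) hT
  have eVB := fun T hT => h.integral_V_mul_B hβ (T := T) hT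
  have cYY := continuousOn_of_eq_add_integral
    (fun T hT => ((iYV T hT).add ((iYB T hT).const_mul σ)).const_mul 2) eYY
  have cYV := continuousOn_of_eq_add_integral
    (fun T hT => ((iVV T hT).add ((iVB T hT).const_mul σ)).sub
      (intervalIntegrable_weight_mul hT (iYY T hT) β)) eYV
  have cYB := continuousOn_of_eq_add_integral
    (fun T hT => (iVB T hT).add
      ((continuous_const.mul continuous_id : Continuous fun s => σ * s).intervalIntegrable 0 T)) eYB
  have cVV := continuousOn_of_eq_add_integral
    (fun T hT => ((intervalIntegrable_weight_mul hT (iYV T hT) β).const_mul (-2)).congr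
      fun s _ => (mul_assoc _ _ _).symm) eVV
  have cVB := continuousOn_of_eq_add_integral
    (fun T hT => (intervalIntegrable_weight_mul hT (iYB T hT) β).neg.congr
      fun s _ => (neg_mul _ _).symm) eVB
  have dYY := fun t ht => hasDerivAt_of_eq_add_integral (by fun_prop) eYY (t := t) ht
  have dYV := fun t ht => hasDerivAt_of_eq_add_integral (by fun_prop) eYV (t := t) ht
  have dYB := fun t ht => hasDerivAt_of_eq_add_integral (by fun_prop) eYB (t := t) ht
  have dVV := fun t ht => hasDerivAt_of_eq_add_integral (by fun_prop) eVV (t := t) ht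
  have dVB := fun t ht => hasDerivAt_of_eq_add_integral (by fun_prop) eVB (t := t) ht
  have key := tendsto_div_of_secondMoment_system (σ := σ) hβ cYY
    (q := fun t => ∫ ω, Y t ω * V t ω ∂P + σ * ∫ ω, Y t ω * B t ω ∂P)
    (r := fun t => ∫ ω, V t ω * V t ω ∂P + 2 * σ * ∫ ω, V t ω * B t ω ∂P + σ ^ 2 * t)
    (by fun_prop) (by fun_prop) dYY
    (fun t ht => ((dYV t ht).add ((dYB t ht).const_mul σ)).congr_deriv (by ring))
    (fun t ht => (((dVV t ht).add ((dVB t ht).const_mul (2 * σ))).add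
      ((hasDerivAt_id t).const_mul (σ ^ 2))).congr_deriv (by ring))
  refine key.congr' ?_
  filter_upwards [eventually_ge_atTop 0] with t ht
  have i1 := hV.integrable_mul hV ht
  have i2 := (hV.integrable_mul hB ht).const_mul (2 * σ)
  have i3 := (hB.integrable_mul hB ht).const_mul (σ ^ 2)
  have i12 : Integrable (fun ω => V t ω * V t ω + 2 * σ * (V t ω * B t ω)) P := i1.add i2
  have e : (fun ω => (V t ω + σ * B t ω) ^ 2) = fun ω =>
      V t ω * V t ω + 2 * σ * (V t ω * B t ω) + σ ^ 2 * (B t ω * B t ω) := by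
    funext ω
    ring
  rw [e, integral_add i12 i3, integral_add i1 i2, integral_const_mul,
    integral_const_mul, h.sq_B t ht]

lemma tendsto_mean (hβ : 0 < β) (h : IsDrivenOscillator P β σ c v Y V B) :
    Tendsto (fun t => ∫ ω, (V t ω + σ * B t ω) ∂P) atTop (nhds 0) := by
  have hY := h.isLocallySquareIntegrable_Y hβ
  have hV := h.isLocallySquareIntegrable_V hβ
  have hB := h.isLocallySquareIntegrable_B
  have cw := continuousOn_weight β
  have h1 : MemLp (fun _ : Ω => (1 : ℝ)) 2 P := memLp_const 1
  have hmean : ∀ t, 0 ≤ t → ∫ ω, (V t ω + σ * B t ω) ∂P = ∫ ω, V t ω ∂P := by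
    intro t ht
    rw [integral_add ((hV t ht).1.integrable one_le_two)
      (((hB t ht).1.integrable one_le_two).const_mul σ), integral_const_mul, h.mean_B t ht,
      mul_zero, add_zero]
  have iY := fun T hT => hY.intervalIntegrable_integral_mul (.const h1) (T := T) hT
  have iV := fun T hT => hV.intervalIntegrable_integral_mul (.const h1) (T := T) hT
  have eY := fun T hT => h.integral_Y_mul hβ h1 (T := T) hT
  have eV := fun T hT => h.integral_V_mul hβ h1 (T := T) hT
  simp only [mul_one] at iY iV eY eV
  have eY' : ∀ T, 0 ≤ T → ∫ ω, Y T ω ∂P =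
      c * ∫ _, (1 : ℝ) ∂P + ∫ s in (0 : ℝ)..T, ∫ ω, V s ω ∂P := by
    intro T hT
    rw [eY T hT]
    congr 1
    refine intervalIntegral.integral_congr fun s hs => ?_
    rw [uIcc_of_le hT] at hs
    exact hmean s hs.1
  have cY := continuousOn_of_eq_add_integral iV eY'
  have cV := continuousOn_of_eq_add_integral
    (fun T hT => (intervalIntegrable_weight_mul hT (iY T hT) β).neg.congr
      fun s _ => (neg_mul _ _).symm) eV
  have key := tendsto_zero_of_mean_system hβ cY cV
    (fun t ht => hasDerivAt_of_eq_add_integral cV eY' ht)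
    (fun t ht => hasDerivAt_of_eq_add_integral (by fun_prop) eV ht)
  refine key.congr' ?_
  filter_upwards [eventually_ge_atTop 0] with t ht using (hmean t ht).symm

end IsDrivenOscillator

lemma IsStdBrownian.map_eq {Ω : Type*} {mΩ : MeasurableSpace Ω} {P : Measure Ω}
    {F : MeasureTheory.Filtration ℝ mΩ} {B : ℝ → Ω → ℝ} (hB : IsStdBrownian P F B) {t : ℝ}
    (ht : 0 ≤ t) : P.map (B t) = gaussianReal 0 (Real.toNNReal t) := by
  have h := hB.2.2.2.1 0 t le_rfl ht
  simpa [hB.2.1] using h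

lemma IsStdBrownian.measurable {Ω : Type*} {mΩ : MeasurableSpace Ω} {P : Measure Ω}
    {F : MeasureTheory.Filtration ℝ mΩ} {B : ℝ → Ω → ℝ} (hB : IsStdBrownian P F B) (t : ℝ) :
    Measurable (B t) :=
  (hB.1 t).mono (F.le t) le_rfl

lemma IsStdBrownian.integral_mul_increment {Ω : Type*} {mΩ : MeasurableSpace Ω} {P : Measure Ω}
    {F : MeasureTheory.Filtration ℝ mΩ} {B : ℝ → Ω → ℝ} (hB : IsStdBrownian P F B)
    {s t : ℝ} (hs : 0 ≤ s) (hst : s ≤ t) {ξ : Ω → ℝ} (hξ : StronglyMeasurable[F s] ξ) :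
    ∫ ω, ξ ω * (B t ω - B s ω) ∂P = 0 := by
  have hm : Measurable fun ω => B t ω - B s ω := (hB.measurable t).sub (hB.measurable s)
  have hind : IndepFun ξ (fun ω => B t ω - B s ω) P := by
    rw [IndepFun_iff_Indep]
    exact indep_of_indep_of_le_left (hB.2.2.2.2 s t hs hst).symm hξ.measurable.comap_le
  have h0 : ∫ ω, (B t ω - B s ω) ∂P = 0 := by
    have := integral_map (μ := P) hm.aemeasurable (f := fun x : ℝ => x)
      measurable_id.aestronglyMeasurable
    rw [← this, hB.2.2.2.1 s t hs hst, integral_id_gaussianReal]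
  have := hind.integral_mul_eq_mul_integral (hξ.mono (F.le s)).aestronglyMeasurable
    hm.aestronglyMeasurable
  rw [h0, mul_zero] at this
  exact this

lemma IsSolutionSFDE.isDrivenOscillator {Ω : Type*} {mΩ : MeasurableSpace Ω} {P : Measure Ω}
    [IsProbabilityMeasure P] {F : MeasureTheory.Filtration ℝ mΩ} {b σ : ℝ} {ψ : ℝ → ℝ}
    {B X : ℝ → Ω → ℝ} (hB : IsStdBrownian P F B) (hX : IsSolutionSFDE P F 0 b σ ψ B X) :
    IsDrivenOscillator P (-b) σ (∫ u in (-1 : ℝ)..0, ψ u) (ψ 0)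
      (fun t ω => (∫ u in (-1 : ℝ)..0, ψ u) + ∫ u in (0 : ℝ)..t, X (max u 0) ω)
      (fun t ω => X (max t 0) ω - σ * B t ω) B := by
  obtain ⟨hXm, hXc, hXe⟩ := hX
  have cX : ∀ ω, Continuous fun t : ℝ => X (max t 0) ω := fun ω =>
    (hXc ω).comp_continuous (by fun_prop) fun t => le_max_right t 0
  have mX : ∀ t : ℝ, Measurable (X (max t 0)) := fun t =>
    ((hXm _ (le_max_right t 0)).mono (F.le _)).measurable
  have jX : StronglyMeasurable (Function.uncurry fun (t : ℝ) ω => X (max t 0) ω) :=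
    (measurable_uncurry_of_continuous_of_measurable cX mX).stronglyMeasurable
  have dY : ∀ ω t, HasDerivAt
      (fun t => (∫ u in (-1 : ℝ)..0, ψ u) + ∫ u in (0 : ℝ)..t, X (max u 0) ω) (X (max t 0) ω) t :=
    fun ω t => (intervalIntegral.integral_hasDerivAt_right ((cX ω).intervalIntegrable _ _)
      (cX ω).aestronglyMeasurable.stronglyMeasurableAtFilter (cX ω).continuousAt).const_add _
  have mYc : ∀ ω, Continuous
      fun t => (∫ u in (-1 : ℝ)..0, ψ u) + ∫ u in (0 : ℝ)..t, X (max u 0) ω := fun ω =>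
    continuous_iff_continuousAt.2 fun t => (dY ω t).continuousAt
  refine ⟨fun t => ?_, fun t => (mX t).sub ((hB.measurable t).const_mul σ), hB.measurable, mYc,
    fun ω => (cX ω).sub ((hB.2.2.1 ω).const_mul σ), hB.2.2.1, ?_, fun t ht => ?_,
    fun t ht => ?_, fun t ht => ?_, fun u s t hu hus hst => ?_⟩
  · simp only [intervalIntegral]
    exact (jX.integral_prod_left.sub jX.integral_prod_left).measurable.const_add _
  · filter_upwards [hXe] with ω hω
    refine ⟨by simp, by simpa [hB.2.1] using hω 0 le_rfl, fun t ht => ⟨?_, ?_⟩⟩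
    · simpa using dY ω t
    · have cw := continuousOn_weight b
      have hcont : ContinuousOn (fun s => b / (1 + s) *
          ((∫ u in (-1 : ℝ)..0, ψ u) + ∫ u in (0 : ℝ)..s, X (max u 0) ω)) (Ici 0) :=
        cw.mul (mYc ω).continuousOn
      refine (hasDerivAt_of_eq_add_integral (p₀ := ψ 0) hcont (fun T hT => ?_) ht).congr_deriv
        (by ring)
      rw [max_eq_left hT, hω T hT, add_sub_cancel_right]
      congr 1
      refine intervalIntegral.integral_congr fun s hs => ?_
      rw [uIcc_of_le hT] at hs
      have : ∫ u in (0 : ℝ)..s, X u ω = ∫ u in (0 : ℝ)..s, X (max u 0) ω := by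
        refine intervalIntegral.integral_congr fun u hu => ?_
        rw [uIcc_of_le hs.1] at hu
        simp only [max_eq_left hu.1]
      simp only [this, zero_mul, zero_add]
  · have h := memLp_id_gaussianReal (μ := 0) (v := Real.toNNReal t) 2
    rw [← hB.map_eq ht, memLp_map_measure_iff measurable_id.aestronglyMeasurable
      (hB.measurable t).aemeasurable] at h
    exact h
  · have := integral_map (μ := P) (hB.measurable t).aemeasurable (f := fun x : ℝ => x)
      measurable_id.aestronglyMeasurable
    rw [← this, hB.map_eq ht, integral_id_gaussianReal]
  · have h1 := integral_map (μ := P) (hB.measurable t).aemeasurable (f := fun x : ℝ => x * x)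
      (measurable_id.mul measurable_id).aestronglyMeasurable
    have h2 := variance_of_integral_eq_zero (μ := gaussianReal 0 (Real.toNNReal t)) (X := id)
      measurable_id.aemeasurable (by simp)
    rw [variance_id_gaussianReal, Real.coe_toNNReal t ht] at h2
    simp only [id, sq] at h2
    rw [← h1, hB.map_eq ht, ← h2]
  · have hst' : StronglyMeasurable[F s] (X u) := (hXm u hu).mono (F.mono hus)
    simpa [max_eq_left hu] using hB.integral_mul_increment (hu.trans hus) hst hst'

theorem sfde_mean_var_bessel {Ω : Type*} {mΩ : MeasurableSpace Ω} (P : Measure Ω) [IsProbabilityMeasure P]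
    (F : MeasureTheory.Filtration ℝ mΩ) (a b σ : ℝ) (ψ : ℝ → ℝ) (B X : ℝ → Ω → ℝ)
    (hσ : 0 < σ) (hψ : ContinuousOn ψ (Set.Icc (-1 : ℝ) 0))
    (hB : IsStdBrownian P F B) (hX : IsSolutionSFDE P F a b σ ψ B X)
    (ha : a = 0) (hb : b < 0) :
    Filter.Tendsto (fun t : ℝ => ∫ ω, X t ω ∂P) Filter.atTop (nhds 0) ∧
    Filter.Tendsto
      (fun t : ℝ => ((∫ ω, (X t ω) ^ 2 ∂P) - (∫ ω, X t ω ∂P) ^ 2) / t)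
      Filter.atTop (nhds (σ ^ 2 / 3)) := by
  subst ha
  have h := IsSolutionSFDE.isDrivenOscillator hB hX
  have hβ : 0 < -b := neg_pos.2 hb
  have hmean : Tendsto (fun t : ℝ => ∫ ω, X t ω ∂P) atTop (nhds 0) := by
    refine (h.tendsto_mean hβ).congr' ?_
    filter_upwards [eventually_ge_atTop 0] with t ht
    simp only [max_eq_left ht, sub_add_cancel]
  refine ⟨hmean, ?_⟩
  have hsq : Tendsto (fun t : ℝ => (∫ ω, (X t ω) ^ 2 ∂P) / t) atTop (nhds (σ ^ 2 / 3)) := by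
    refine (h.tendsto_secondMoment_div hβ).congr' ?_
    filter_upwards [eventually_ge_atTop 0] with t ht
    simp only [max_eq_left ht, sub_add_cancel]
  have h0 := hsq.sub ((hmean.pow 2).div_atTop tendsto_id)
  rw [sub_zero] at h0
  exact h0.congr fun t => (sub_div _ _ _).symm
end
end
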